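/- arXiv:2511.15491 — 7 statements merged into one kernel-verified Lean document; each statement's English description precedes it below -/
import Mathlib

section
/- For every integer r ≥ 1 there is a constant d depending only on r (one may take d = 5r) such that, for every function s : ℕ → ℕ with s(n) = o(log n), there is no r-local proof-labeling scheme of size s certifying the property AMOS on the class of connected graphs of diameter at most d in which the n vertices carry distinct identifiers from {1, …, n²}. In other words, certifying AMOS in graphs of bounded diameter requires certificates of size Ω(log n). -/
open SimpleGraph Filter

/-- A network configuration: a finite connected simple graph whose vertices carry
an input bit (`sel`, "selected") and distinct identifiers (`ids`). -/
structure Network where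
  n : ℕ
  G : SimpleGraph (Fin n)
  conn : G.Connected
  sel : Fin n → Bool
  ids : Fin n → ℕ
  ids_inj : Function.Injective ids

/-- AMOS: at most one vertex is selected. -/
def Network.AMOS (N : Network) : Prop :=
  ∀ u v : Fin N.n, N.sel u = true → N.sel v = true → u = v

/-- The radius-`r` ball around `v`. -/
def Network.ball (N : Network) (r : ℕ) (v : Fin N.n) : Set (Fin N.n) :=
  {u : Fin N.n | N.G.dist v u ≤ r}

lemma Network.center_mem_ball (N : Network) (r : ℕ) (v : Fin N.n) :
    v ∈ N.ball r v := by
  simp [Network.ball, SimpleGraph.dist_self]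

/-- A verifier: at each vertex of each network, given certificates (bit strings),
it accepts (`true`) or rejects (`false`). -/
def Verifier : Type :=
  ∀ N : Network, (Fin N.n → List Bool) → Fin N.n → Bool

/-- `r`-locality: the decision at `v` only depends on the radius-`r` ball around `v`,
i.e. on the subgraph induced by the vertices at distance at most `r` from `v`,
together with the input bits, the identifiers and the certificates in the ball. -/
def IsLocalVerifier (r : ℕ) (A : Verifier) : Prop :=
  ∀ (N N' : Network) (P : Fin N.n → List Bool) (P' : Fin N'.n → List Bool)
    (v : Fin N.n) (v' : Fin N'.n)
    (φ : (N.G.induce (N.ball r v)) ≃g (N'.G.induce (N'.ball r v'))),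
    (∀ x : N.ball r v, N.sel x.1 = N'.sel (φ x).1) →
    (∀ x : N.ball r v, N.ids x.1 = N'.ids (φ x).1) →
    (∀ x : N.ball r v, P x.1 = P' (φ x).1) →
    φ ⟨v, N.center_mem_ball r v⟩ = ⟨v', N'.center_mem_ball r v'⟩ →
    A N P v = A N' P' v'

/-- An `r`-local proof-labeling scheme of size `size` for the property `Pr`
on the class of networks `Net`: a prover assigning certificates of at most
`size n` bits on yes-instances (completeness), such that on no-instances every
certificate assignment is rejected at some vertex (soundness). -/
structure PLS (r : ℕ) (size : ℕ → ℕ) (Net : Network → Prop) (Pr : Network → Prop) where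
  prover : ∀ N : Network, Fin N.n → List Bool
  verifier : Verifier
  verifier_local : IsLocalVerifier r verifier
  prover_size : ∀ N : Network, Net N → Pr N → ∀ v, (prover N v).length ≤ size N.n
  completeness : ∀ N : Network, Net N → Pr N → ∀ v, verifier N (prover N) v = true
  soundness : ∀ N : Network, Net N → ¬ Pr N →
    ∀ P : Fin N.n → List Bool, ∃ v, verifier N P v = false

/-- A vertex at distance at most `k + 1` from `x` is at distance at most `k` from `x`, or adjacent
to such a vertex. -/
lemma dist_le_succ_cases {V : Type*} {G : SimpleGraph V} (hG : G.Connected) {x y : V} {k : ℕ}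
    (h : G.dist x y ≤ k + 1) : G.dist x y ≤ k ∨ ∃ z, G.dist x z ≤ k ∧ G.Adj z y := by
  obtain ⟨w, hw⟩ := (hG y x).exists_walk_length_eq_dist
  rw [SimpleGraph.dist_comm] at hw
  cases w with
  | nil => left; simp
  | @cons _ z _ hadj w =>
    right
    refine ⟨z, ?_, hadj.symm⟩
    rw [SimpleGraph.dist_comm]
    have := SimpleGraph.dist_le w
    simp only [SimpleGraph.Walk.length_cons] at hw
    omega

lemma dist_le_of_section {V W : Type*} {G : SimpleGraph V} {H : SimpleGraph W}
    (hG : G.Connected) (hH : H.Connected) {r : ℕ} {x : V} {s : V → W}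
    (hs : ∀ y z, G.dist x y ≤ r → G.dist x z ≤ r → G.Adj y z → H.Adj (s y) (s z))
    {k : ℕ} (hk : k ≤ r) {y : V} (hy : G.dist x y ≤ k) : H.dist (s x) (s y) ≤ k := by
  induction k generalizing y with
  | zero =>
    have : x = y := hG.dist_eq_zero_iff.mp (by omega)
    simp [this]
  | succ k ih =>
    rcases dist_le_succ_cases hG hy with h | ⟨z, hz, hadj⟩
    · exact (ih (by omega) h).trans (by omega)
    · have h1 := ih (by omega) hz
      have h2 := hs z y (by omega) (by omega) hadj
      have h3 := hH.dist_triangle (u := s x) (v := s z) (w := s y)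
      have h4 := SimpleGraph.dist_eq_one_iff_adj.mpr h2
      omega

lemma section_proj_eq_of_dist_le {V W : Type*} {G : SimpleGraph V} {H : SimpleGraph W}
    (hG : G.Connected) (hH : H.Connected) {r : ℕ} {x : V} {s : V → W} {p : W → V}
    (hp : ∀ u v, H.Adj u v → G.Adj (p u) (p v)) (hps : ∀ y, p (s y) = y)
    (huniq : ∀ u v v', H.Adj u v → H.Adj u v' → p v = p v' → v = v')
    (hs : ∀ y z, G.dist x y ≤ r → G.dist x z ≤ r → G.Adj y z → H.Adj (s y) (s z))
    {k : ℕ} (hk : k ≤ r) {u : W} (hu : H.dist (s x) u ≤ k) :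
    G.dist x (p u) ≤ k ∧ s (p u) = u := by
  induction k generalizing u with
  | zero =>
    have : s x = u := hH.dist_eq_zero_iff.mp (by omega)
    simp [← this, hps]
  | succ k ih =>
    rcases dist_le_succ_cases hH hu with h | ⟨z, hz, hadj⟩
    · exact ⟨(ih (by omega) h).1.trans (by omega), (ih (by omega) h).2⟩
    · obtain ⟨h1, h2⟩ := ih (by omega) hz
      have h3 := hp _ _ hadj
      have h4 := SimpleGraph.dist_eq_one_iff_adj.mpr h3
      have h5 := hG.dist_triangle (u := x) (v := p z) (w := p u)
      have h6 := hs _ _ (by omega) (by omega) h3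
      rw [h2] at h6
      exact ⟨by omega, huniq _ _ _ h6 hadj (hps _)⟩

/-- A local verifier cannot distinguish `x` from `s x` when `s` is a section, over the ball of `x`,
of a locally injective homomorphism `p`, and `s` respects all the labels of that ball. -/
lemma IsLocalVerifier.eq_of_section {r : ℕ} {A : Verifier} (hA : IsLocalVerifier r A)
    {N N' : Network} {P : Fin N.n → List Bool} {P' : Fin N'.n → List Bool} {x : Fin N.n}
    {s : Fin N.n → Fin N'.n} {p : Fin N'.n → Fin N.n}
    (hp : ∀ u v, N'.G.Adj u v → N.G.Adj (p u) (p v)) (hps : ∀ y, p (s y) = y)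
    (huniq : ∀ u v v', N'.G.Adj u v → N'.G.Adj u v' → p v = p v' → v = v')
    (hs : ∀ y z, N.G.dist x y ≤ r → N.G.dist x z ≤ r → N.G.Adj y z → N'.G.Adj (s y) (s z))
    (hsel : ∀ y, N.G.dist x y ≤ r → N.sel y = N'.sel (s y))
    (hids : ∀ y, N.G.dist x y ≤ r → N.ids y = N'.ids (s y))
    (hP : ∀ y, N.G.dist x y ≤ r → P y = P' (s y)) :
    A N P x = A N' P' (s x) := by
  have key := fun u => section_proj_eq_of_dist_le N.conn N'.conn (u := u) hp hps huniq hs le_rfl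
  let φ : (N.G.induce (N.ball r x)) ≃g (N'.G.induce (N'.ball r (s x))) :=
    { toFun := fun y => ⟨s y.1, dist_le_of_section N.conn N'.conn hs le_rfl y.2⟩
      invFun := fun u => ⟨p u.1, (key u.1 u.2).1⟩
      left_inv := fun y => Subtype.ext (hps y.1)
      right_inv := fun u => Subtype.ext (key u.1 u.2).2
      map_rel_iff' := by
        rintro ⟨y, hy⟩ ⟨z, hz⟩
        constructor
        · intro h
          have := hp (s y) (s z) h
          rwa [hps, hps] at this
        · exact fun h => hs y z hy hz h }
  exact hA N N' P P' x (s x) φ (fun y => hsel y.1 y.2) (fun y => hids y.1 y.2)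
    (fun y => hP y.1 y.2) rfl

/-- If the colour set is small compared to both sides, every edge colouring of a complete bipartite
graph has a monochromatic four-cycle. -/
lemma exists_monochromatic_four_cycle {α β C : Type*} [Fintype α] [Fintype β] [Fintype C]
    (F : α → β → C) (hα : Fintype.card C < Fintype.card α)
    (hβ : Fintype.card α * (Fintype.card α * Fintype.card C) < Fintype.card β) :
    ∃ (a : Bool → α) (b : Bool → β) (c : C), a.Injective ∧ b.Injective ∧
      ∀ i j, F (a i) (b j) = c := by
  have h1 : ∀ b, ∃ a a', a ≠ a' ∧ F a b = F a' b := fun b =>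
    Fintype.exists_ne_map_eq_of_card_lt (fun a => F a b) hα
  choose f g hne heq using h1
  obtain ⟨b, b', hb, h⟩ := Fintype.exists_ne_map_eq_of_card_lt
    (fun b => (f b, g b, F (f b) b)) (by simpa using hβ)
  simp only [Prod.mk.injEq] at h
  obtain ⟨hf, hg, hF⟩ := h
  refine ⟨fun i => bif i then f b else g b, fun i => bif i then b else b', F (f b) b, ?_, ?_, ?_⟩
  · exact Bool.injective_iff.mpr (hne b).symm
  · exact Bool.injective_iff.mpr hb.symm
  · have e1 := heq b
    have e2 := heq b'
    rw [← hf, ← hg] at e2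
    rw [← hf] at hF
    rintro (_ | _) (_ | _) <;> simp_all

/-- Oriented edges of the cycle `0, …, 3q - 1` with pendant vertices `3q, …, n - 1` at `0`. -/
def BaseEdge (q x y : ℕ) : Prop :=
  (y = x + 1 ∧ y < 3 * q) ∨ (x = 0 ∧ 0 < y ∧ 3 * q ≤ y + 1)

/-- The cycle of length `3q` with `n - 3q` pendant vertices attached to the vertex `0`. -/
def baseGraph (q n : ℕ) : SimpleGraph (Fin n) where
  Adj x y := BaseEdge q x y ∨ BaseEdge q y x
  symm := ⟨fun _ _ h => h.symm⟩
  loopless := ⟨fun x h => by simp only [BaseEdge] at h; omega⟩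

/-- The pair `x, y` is the edge `{2q - 1, 2q}`. -/
def Crosses (q x y : ℕ) : Prop :=
  (x + 1 = 2 * q ∧ y = 2 * q) ∨ (y + 1 = 2 * q ∧ x = 2 * q)

/-- The connected double cover of `baseGraph q n`, with sheets exchanged along `{2q - 1, 2q}`. -/
def coverGraph (q n : ℕ) : SimpleGraph (Bool × Fin n) where
  Adj u v := (baseGraph q n).Adj u.2 v.2 ∧ (u.1 = v.1 ↔ ¬ Crosses q u.2 v.2)
  symm := ⟨fun u v h => ⟨h.1.symm, by
    have := h.2
    simp only [Crosses] at this ⊢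
    rw [eq_comm, this]
    omega⟩⟩
  loopless := ⟨fun _ h => h.1.ne rfl⟩

lemma coverGraph_adj_unique {q n : ℕ} {u v v' : Bool × Fin n} (h : (coverGraph q n).Adj u v)
    (h' : (coverGraph q n).Adj u v') (hv : v.2 = v'.2) : v = v' := by
  obtain ⟨i, x⟩ := u
  obtain ⟨j, y⟩ := v
  obtain ⟨j', y'⟩ := v'
  obtain rfl : y = y' := hv
  have h1 := h.2.trans h'.2.symm
  simp only [Prod.mk.injEq, and_true]
  revert h1
  cases i <;> cases j <;> cases j' <;> simp

/-- There is a walk of length at most `k` from `u` to `v`. -/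
def WalkLE {V : Type*} (G : SimpleGraph V) (k : ℕ) (u v : V) : Prop :=
  ∃ w : G.Walk u v, w.length ≤ k

namespace WalkLE

variable {V W : Type*} {G : SimpleGraph V} {H : SimpleGraph W} {u v w : V} {k l : ℕ}

lemma mono (h : WalkLE G k u v) (hkl : k ≤ l) : WalkLE G l u v :=
  ⟨h.choose, h.choose_spec.trans hkl⟩

lemma symm (h : WalkLE G k u v) : WalkLE G k v u := by
  obtain ⟨w, hw⟩ := h
  exact ⟨w.reverse, by simpa using hw⟩

lemma trans (h : WalkLE G k u v) (h' : WalkLE G l v w) : WalkLE G (k + l) u w := by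
  obtain ⟨w, hw⟩ := h
  obtain ⟨w', hw'⟩ := h'
  exact ⟨w.append w', by rw [SimpleGraph.Walk.length_append]; omega⟩

lemma of_adj (h : G.Adj u v) : WalkLE G 1 u v := ⟨h.toWalk, by simp⟩

lemma map (h : WalkLE G k u v) (f : G →g H) : WalkLE H k (f u) (f v) := by
  obtain ⟨w, hw⟩ := h
  exact ⟨w.map f, by simpa using hw⟩

lemma dist_le (h : WalkLE G k u v) : G.dist u v ≤ k := by
  obtain ⟨w, hw⟩ := h
  exact (SimpleGraph.dist_le w).trans hw

lemma connected [Nonempty V] (h : ∀ u v, WalkLE G k u v) : G.Connected :=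
  { preconnected := fun u v => ⟨(h u v).choose⟩ }

end WalkLE

lemma coverGraph_walkLE_low {q n : ℕ} (hn : 3 * q ≤ n) (i : Bool) (x : ℕ) (hx : x < 2 * q) :
    WalkLE (coverGraph q n) x (i, ⟨x, by omega⟩) (i, ⟨0, by omega⟩) := by
  induction x with
  | zero => exact ⟨.nil, by simp⟩
  | succ x ih =>
    refine ((WalkLE.of_adj ?_).trans (ih (by omega))).mono (by omega)
    simp only [coverGraph, baseGraph, BaseEdge, Crosses, true_iff, true_and]
    omega

lemma coverGraph_walkLE_high {q n : ℕ} (hn : 3 * q ≤ n) (i : Bool) (m : ℕ) (hm : m < q) :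
    WalkLE (coverGraph q n) (m + 1) (i, ⟨3 * q - 1 - m, by omega⟩) (i, ⟨0, by omega⟩) := by
  induction m with
  | zero =>
    refine WalkLE.of_adj ?_
    simp only [coverGraph, baseGraph, BaseEdge, Crosses, true_iff, true_and]
    omega
  | succ m ih =>
    refine ((WalkLE.of_adj ?_).trans (ih (by omega))).mono (by omega)
    simp only [coverGraph, baseGraph, BaseEdge, Crosses, true_iff]
    omega

lemma coverGraph_walkLE_hub {q n : ℕ} (hq : 0 < q) (hn : 3 * q ≤ n) (i : Bool) (x : Fin n) :
    WalkLE (coverGraph q n) (2 * q) (i, x) (i, ⟨0, by omega⟩) := by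
  obtain ⟨x, hx⟩ := x
  rcases lt_or_ge x (2 * q) with h | h
  · exact (coverGraph_walkLE_low hn i x h).mono (by omega)
  rcases lt_or_ge x (3 * q) with h' | h'
  · have := coverGraph_walkLE_high hn i (3 * q - 1 - x) (by omega)
    have e : 3 * q - 1 - (3 * q - 1 - x) = x := by omega
    simp only [e] at this
    exact this.mono (by omega)
  · refine (WalkLE.of_adj ?_).mono (by omega : 1 ≤ 2 * q)
    simp only [coverGraph, baseGraph, BaseEdge, Crosses, true_iff, true_and]
    omega

lemma coverGraph_walkLE {q n : ℕ} (hq : 0 < q) (hn : 3 * q ≤ n) (u v : Bool × Fin n) :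
    WalkLE (coverGraph q n) (9 * q) u v := by
  obtain ⟨i, x⟩ := u
  obtain ⟨j, y⟩ := v
  have hx := coverGraph_walkLE_hub hq hn i x
  have hy := (coverGraph_walkLE_hub hq hn j y).symm
  by_cases hij : i = j
  · subst hij
    exact (hx.trans hy).mono (by omega)
  · have h1 := (coverGraph_walkLE_hub hq hn i ⟨2 * q - 1, by omega⟩).symm
    have h2 := coverGraph_walkLE_hub hq hn j ⟨2 * q, by omega⟩
    have h3 : (coverGraph q n).Adj (i, ⟨2 * q - 1, by omega⟩) (j, ⟨2 * q, by omega⟩) := by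
      refine ⟨Or.inl (Or.inl ⟨?_, ?_⟩), iff_of_false hij (not_not.mpr (Or.inl ⟨?_, rfl⟩))⟩ <;>
        dsimp only <;> omega
    exact ((((hx.trans h1).trans (WalkLE.of_adj h3)).trans h2).trans hy).mono (by omega)

lemma baseGraph_walkLE {q n : ℕ} (hq : 0 < q) (hn : 3 * q ≤ n) (x y : Fin n) :
    WalkLE (baseGraph q n) (9 * q) x y :=
  (coverGraph_walkLE hq hn (false, x) (false, y)).map
    (⟨Prod.snd, fun h => h.1⟩ : coverGraph q n →g baseGraph q n)

/-- Vertices within distance `k` of `2q` lie within `k` of it along the cycle. -/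
lemma baseGraph_near {q n k : ℕ} (hG : (baseGraph q n).Connected) (hk : k < q) {x y : Fin n}
    (hx : x.val = 2 * q) (h : (baseGraph q n).dist x y ≤ k) :
    2 * q ≤ y.val + k ∧ y.val ≤ 2 * q + k := by
  induction k generalizing y with
  | zero =>
    have : x = y := hG.dist_eq_zero_iff.mp (by omega)
    subst this
    omega
  | succ k ih =>
    rcases dist_le_succ_cases hG h with h | ⟨z, hz, hadj⟩
    · have := ih (by omega) h
      omega
    · have := ih (by omega) hz
      simp only [baseGraph, BaseEdge] at hadj
      omega

/-- The label of a vertex: `b` on the block `q, …, 2q - 1` and `a` elsewhere. -/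
def blockLabel (q a b x : ℕ) : ℕ := if q ≤ x ∧ x < 2 * q then b else a

lemma add_mul_inj {n x y l m : ℕ} (hx : x < n) (hy : y < n)
    (h : 1 + x + n * l = 1 + y + n * m) : x = y ∧ l = m := by
  have hxy : x = y := by
    have := congrArg (· % n) (show x + n * l = y + n * m by omega)
    simpa [Nat.mod_eq_of_lt hx, Nat.mod_eq_of_lt hy] using this
  subst hxy
  exact ⟨rfl, Nat.eq_of_mul_eq_mul_left (by omega : 0 < n) (by omega)⟩

lemma blockId_bounds {q n a b x : ℕ} (hx : x < n) (ha : a < n) (hb : b < n) :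
    1 ≤ 1 + x + n * blockLabel q a b x ∧ 1 + x + n * blockLabel q a b x ≤ n ^ 2 := by
  have hl : blockLabel q a b x + 1 ≤ n := by
    unfold blockLabel
    split_ifs <;> omega
  refine ⟨by omega, ?_⟩
  nlinarith [Nat.mul_le_mul_left n hl]

/-- The base graph with vertex `0` selected and the two blocks labelled by `a` and `b`. -/
def baseNetwork {q n : ℕ} (hq : 0 < q) (hn : 3 * q ≤ n) (a b : ℕ) : Network where
  n := n
  G := baseGraph q n
  conn := haveI : Nonempty (Fin n) := ⟨⟨0, by omega⟩⟩
    WalkLE.connected (baseGraph_walkLE hq hn)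
  sel x := decide (x.val = 0)
  ids x := 1 + x.val + n * blockLabel q a b x
  ids_inj x y h := Fin.ext (add_mul_inj x.2 y.2 h).1

/-- A numbering of the vertices of the double cover. -/
def sheetEquiv (n : ℕ) : Fin (2 * n) ≃ Bool × Fin n :=
  finProdFinEquiv.symm.trans (Equiv.prodCongr finTwoEquiv (Equiv.refl _))

lemma coverNetwork_walkLE {q n : ℕ} (hq : 0 < q) (hn : 3 * q ≤ n) (u v : Fin (2 * n)) :
    WalkLE ((coverGraph q n).comap (sheetEquiv n)) (9 * q) u v := by
  have := (coverGraph_walkLE hq hn (sheetEquiv n u) (sheetEquiv n v)).map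
    (SimpleGraph.Iso.comap (sheetEquiv n) (coverGraph q n)).symm.toHom
  simpa using this

/-- The double cover, whose sheet `i` has its blocks labelled by `a i` and `b i`. -/
def coverNetwork {q n : ℕ} (hq : 0 < q) (hn : 3 * q ≤ n) {a b : Bool → Fin n}
    (ha : a.Injective) (hb : b.Injective) : Network where
  n := 2 * n
  G := (coverGraph q n).comap (sheetEquiv n)
  conn := haveI : Nonempty (Fin (2 * n)) := ⟨⟨0, by omega⟩⟩
    WalkLE.connected (coverNetwork_walkLE hq hn)
  sel u := decide ((sheetEquiv n u).2.val = 0)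
  ids u := 1 + (sheetEquiv n u).2.val +
    n * blockLabel q (a (sheetEquiv n u).1) (b (sheetEquiv n u).1) (sheetEquiv n u).2
  ids_inj u v h := by
    apply (sheetEquiv n).injective
    beta_reduce at h
    generalize sheetEquiv n u = u' at h ⊢
    generalize sheetEquiv n v = v' at h ⊢
    obtain ⟨i, x⟩ := u'
    obtain ⟨j, y⟩ := v'
    obtain ⟨h1, h2⟩ := add_mul_inj x.2 y.2 h
    obtain rfl : x = y := Fin.ext h1
    simp only [blockLabel] at h2
    simp only [Prod.mk.injEq, and_true]
    split_ifs at h2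
    · exact hb (Fin.ext h2)
    · exact ha (Fin.ext h2)

/-- The certificates of length at most `s` on the cycle, encoded in a finite type. -/
def cycleCertificates {n q : ℕ} (s : ℕ) (hn : 3 * q ≤ n) (P : Fin n → List Bool) :
    Fin (3 * q) → Fin s → Option Bool :=
  fun x i => (P (Fin.castLE hn x))[i.val]?

lemma eq_of_cycleCertificates_eq {n q s : ℕ} (hn : 3 * q ≤ n) {P P' : Fin n → List Bool}
    (hP : ∀ x, (P x).length ≤ s) (hP' : ∀ x, (P' x).length ≤ s)
    (h : cycleCertificates s hn P = cycleCertificates s hn P') {x : Fin n} (hx : x.val < 3 * q) :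
    P x = P' x := by
  apply List.ext_getElem?
  intro i
  rcases lt_or_ge i s with hi | hi
  · exact congrFun (congrFun h ⟨x.val, hx⟩) ⟨i, hi⟩
  · rw [List.getElem?_eq_none ((hP x).trans hi), List.getElem?_eq_none ((hP' x).trans hi)]

/-- Certificates of size `o(log n)` on `c` vertices take few values compared to `n`. -/
lemma exists_few_certificates {s : ℕ → ℕ}
    (hs : (fun n : ℕ => (s n : ℝ)) =o[atTop] fun n : ℕ => Real.log n) (c m : ℕ) :
    ∃ n, m ≤ n ∧ ((3 ^ s n) ^ c + 1) * (((3 ^ s n) ^ c + 1) * (3 ^ s n) ^ c) < n := by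
  have hε : (0 : ℝ) < 1 / (12 * (c + 1)) := by positivity
  obtain ⟨n, hsn, hn⟩ := ((hs.def hε).and (eventually_ge_atTop (max m 17))).exists
  refine ⟨n, (le_max_left _ _).trans hn, ?_⟩
  have hn17 : 17 ≤ n := (le_max_right _ _).trans hn
  have hn0 : (0 : ℝ) < n := by positivity
  have hlog : 0 ≤ Real.log n := Real.log_natCast_nonneg n
  rw [Real.norm_of_nonneg (by positivity), Real.norm_of_nonneg hlog] at hsn
  set k := (3 ^ s n) ^ c with hk
  have hk1 : 1 ≤ k := Nat.one_le_pow _ _ (by positivity)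
  have hle : (k + 1) * ((k + 1) * k) ≤ 4 * k ^ 3 := by
    nlinarith [Nat.mul_le_mul hk1 hk1]
  refine hle.trans_lt ?_
  have hlogk : Real.log k ≤ 2 * c * s n := by
    have : Real.log 3 ≤ 2 := by
      have := Real.log_le_sub_one_of_pos (show (0 : ℝ) < 3 by norm_num)
      linarith
    rw [hk]
    push_cast
    rw [Real.log_pow, Real.log_pow]
    have := mul_le_mul_of_nonneg_left this (show (0 : ℝ) ≤ c * s n by positivity)
    linarith
  have hcs : (c : ℝ) * s n ≤ Real.log n / 12 := by
    have h1 : (c + 1 : ℝ) * s n ≤ Real.log n / 12 := by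
      calc (c + 1 : ℝ) * s n ≤ (c + 1) * (1 / (12 * (c + 1)) * Real.log n) := by gcongr
        _ = Real.log n / 12 := by field_simp
    have h2 : (0 : ℝ) ≤ s n := by positivity
    linarith
  have hlog4 : 2 * Real.log 4 < Real.log n := by
    have h1 : Real.log (4 ^ 2) < Real.log n := by
      apply Real.log_lt_log (by norm_num)
      have : (17 : ℝ) ≤ n := by exact_mod_cast hn17
      linarith
    rw [Real.log_pow] at h1
    exact_mod_cast h1
  have hkpos : (0 : ℝ) < k := by exact_mod_cast hk1
  have : Real.log (4 * (k : ℝ) ^ 3) < Real.log n := by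
    rw [Real.log_mul (by norm_num) (by positivity), Real.log_pow]
    push_cast
    linarith
  exact_mod_cast (Real.log_lt_log_iff (by positivity) hn0).mp this

/-- In the double cover, a local verifier accepts certificates that agree, on the ball of each
vertex, with accepted certificates of a base network. -/
lemma verifier_base_eq_cover {q n r : ℕ} (hq : 0 < q) (hn : 3 * q ≤ n) {a b : Bool → Fin n}
    (ha : a.Injective) (hb : b.Injective) {A : Verifier} (hA : IsLocalVerifier r A)
    {P : Fin n → List Bool} {Q : Bool × Fin n → List Bool} (σ : Fin n → Bool) (a' b' : ℕ)
    (x : Fin n)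
    (hσ : ∀ y z, (baseGraph q n).dist x y ≤ r → (baseGraph q n).dist x z ≤ r →
      (baseGraph q n).Adj y z → (σ y = σ z ↔ ¬ Crosses q y z))
    (hids : ∀ y, (baseGraph q n).dist x y ≤ r →
      blockLabel q a' b' y = blockLabel q (a (σ y)) (b (σ y)) y)
    (hP : ∀ y, (baseGraph q n).dist x y ≤ r → P y = Q (σ y, y)) :
    A (baseNetwork hq hn a' b') P x =
      A (coverNetwork hq hn ha hb) (fun u => Q (sheetEquiv n u))
        ((sheetEquiv n).symm (σ x, x)) := by
  refine hA.eq_of_section (N := baseNetwork hq hn a' b') (N' := coverNetwork hq hn ha hb)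
    (s := fun y => (sheetEquiv n).symm (σ y, y)) (p := fun u => (sheetEquiv n u).2)
    ?_ ?_ ?_ ?_ ?_ ?_ ?_
  · exact fun u v h => h.1
  · intro y
    simp
  · exact fun u v v' h h' hv => (sheetEquiv n).injective (coverGraph_adj_unique h h' hv)
  · intro y z hy hz hadj
    have : (coverGraph q n).Adj (σ y, y) (σ z, z) := ⟨hadj, hσ y z hy hz hadj⟩
    simpa [coverNetwork] using this
  · intro y _
    simp [coverNetwork, baseNetwork]
  · intro y hy
    simp [coverNetwork, baseNetwork, hids y hy]
  · intro y hy
    simpa using hP y hy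

/-- Certifying AMOS in graphs of bounded diameter requires certificates of size
`Ω(log n)`: for every `r ≥ 1` there is a constant `d` such that no `r`-local
proof-labeling scheme of size `o(log n)` certifies AMOS on connected graphs of
diameter at most `d` whose `n` vertices carry distinct identifiers from `{1, …, n²}`. -/
theorem amos_lower_bound_bounded_diameter (r : ℕ) (hr : 1 ≤ r) :
    ∃ d : ℕ, ∀ s : ℕ → ℕ,
      ((fun n : ℕ => (s n : ℝ)) =o[atTop] fun n : ℕ => Real.log n) →
      IsEmpty (PLS r s
        (fun N => (∀ u v : Fin N.n, N.G.dist u v ≤ d) ∧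
          (∀ v : Fin N.n, 1 ≤ N.ids v ∧ N.ids v ≤ N.n ^ 2))
        Network.AMOS) := by
  have hq : 0 < 2 * r + 1 := by omega
  refine ⟨9 * (2 * r + 1), fun s hs => ⟨fun S => ?_⟩⟩
  generalize hqr : 2 * r + 1 = q at hq S
  obtain ⟨n, hn, hcard⟩ := exists_few_certificates hs (3 * q) (3 * q)
  set k := (3 ^ s n) ^ (3 * q) with hk
  have hk1 : 1 ≤ k := Nat.one_le_pow _ _ (by positivity)
  have hkn : k + 1 ≤ n := by
    nlinarith [Nat.mul_le_mul_left (k + 1) (Nat.mul_le_mul_left (k + 1) hk1)]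
  have hnet : ∀ a b : Fin n, (∀ u v, (baseNetwork hq hn a b).G.dist u v ≤ 9 * q) ∧
      ∀ v, 1 ≤ (baseNetwork hq hn a b).ids v ∧
        (baseNetwork hq hn a b).ids v ≤ (baseNetwork hq hn a b).n ^ 2 := fun a b =>
    ⟨fun u v => (baseGraph_walkLE hq hn u v).dist_le, fun v => blockId_bounds v.2 a.2 b.2⟩
  have hamos : ∀ a b : Fin n, (baseNetwork hq hn a b).AMOS := fun a b u v hu hv => by
    simp only [baseNetwork, decide_eq_true_eq] at hu hv
    exact Fin.ext (hu.trans hv.symm)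
  let P : Fin n → Fin n → Fin n → List Bool := fun a b => S.prover (baseNetwork hq hn a b)
  have hsize : ∀ a b x, (P a b x).length ≤ s n := fun a b x =>
    S.prover_size _ (hnet a b) (hamos a b) x
  have hacc : ∀ (a b : Fin n) (x : Fin n),
      S.verifier (baseNetwork hq hn a b) (P a b) x = true := fun a b x =>
    S.completeness _ (hnet a b) (hamos a b) x
  have hC : Fintype.card (Fin (3 * q) → Fin (s n) → Option Bool) = k := by simp [hk]
  obtain ⟨a₀, b, c, ha₀, hb, hmono⟩ := exists_monochromatic_four_cycle
    (fun (a : Fin (k + 1)) (b : Fin n) => cycleCertificates (s n) hn (P (Fin.castLE hkn a) b))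
    (by rw [hC]; simp) (by rw [hC]; simpa using hcard)
  let a : Bool → Fin n := fun i => Fin.castLE hkn (a₀ i)
  have ha : a.Injective := (Fin.castLE_injective hkn).comp ha₀
  have hcyc : ∀ i j i' j' (x : Fin n), x.val < 3 * q → P (a i) (b j) x = P (a i') (b j') x :=
    fun i j i' j' x hx => eq_of_cycleCertificates_eq hn (hsize _ _) (hsize _ _)
      ((hmono i j).trans (hmono i' j').symm) hx
  let Q : Bool × Fin n → List Bool := fun u => P (a u.1) (b u.1) u.2
  obtain ⟨v, hv⟩ := S.soundness (coverNetwork hq hn ha hb)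
    ⟨fun u v => (coverNetwork_walkLE hq hn u v).dist_le, fun v => by
      have h := blockId_bounds (q := q) (sheetEquiv n v).2.2 (a (sheetEquiv n v).1).2
        (b (sheetEquiv n v).1).2
      exact ⟨h.1, h.2.trans (Nat.pow_le_pow_left (show n ≤ 2 * n by omega) 2)⟩⟩
    (fun h => by
      have := h ((sheetEquiv n).symm (false, ⟨0, by omega⟩))
        ((sheetEquiv n).symm (true, ⟨0, by omega⟩)) (by simp [coverNetwork])
        (by simp [coverNetwork])
      simpa using (sheetEquiv n).symm.injective this)
    (fun u => Q (sheetEquiv n u))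
  obtain ⟨⟨i, x⟩, rfl⟩ := (sheetEquiv n).symm.surjective v
  have hconn : (baseGraph q n).Connected := (baseNetwork hq hn 0 0).conn
  let m : Fin n := ⟨2 * q, by omega⟩
  by_cases hm : (baseGraph q n).dist x m ≤ r
  · have hball : ∀ y, (baseGraph q n).dist x y ≤ r → q < y.val ∧ y.val < 3 * q := by
      intro y hy
      have h1 := hconn.dist_triangle (u := m) (v := x) (w := y)
      rw [SimpleGraph.dist_comm (u := m) (v := x)] at h1
      have := baseGraph_near (k := 2 * r) hconn (by omega) (x := m) rfl
        (show (baseGraph q n).dist m y ≤ 2 * r by omega)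
      omega
    obtain ⟨j, hj⟩ : ∃ j : Bool, (if x.val < 2 * q then j else !j) = i := by
      by_cases hx : x.val < 2 * q
      · exact ⟨i, by simp [hx]⟩
      · exact ⟨!i, by simp [hx]⟩
    have h := verifier_base_eq_cover hq hn ha hb S.verifier_local (P := P (a !j) (b j)) (Q := Q)
      (fun y => if y.val < 2 * q then j else !j) (a !j) (b j) x
      (fun y z hy hz hadj => by
        have := hball y hy
        have := hball z hz
        simp only [baseGraph, BaseEdge] at hadj
        simp only [Crosses]
        split_ifs <;> simp <;> omega)
      (fun y hy => by
        have := hball y hy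
        simp only [blockLabel]
        by_cases h2 : y.val < 2 * q
        · simp [h2, this.1.le]
        · simp [h2])
      (fun y hy => hcyc _ _ _ _ y (hball y hy).2)
    simp only [hj] at h
    rw [hacc, hv] at h
    exact absurd h (by simp)
  · have hne : ∀ y, (baseGraph q n).dist x y ≤ r → y.val ≠ 2 * q := by
      intro y hy h
      obtain rfl : y = m := Fin.ext h
      exact hm hy
    have h := verifier_base_eq_cover hq hn ha hb S.verifier_local (P := P (a i) (b i)) (Q := Q)
      (fun _ => i) (a i) (b i) x
      (fun y z hy hz _ => by
        have := hne y hy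
        have := hne z hz
        simp only [Crosses, true_iff]
        omega)
      (fun _ _ => rfl) (fun _ _ => rfl)
    rw [hacc, hv] at h
    exact absurd h (by simp)
end

section
/- For every integer r ≥ 1 there is a constant d depending only on r such that, for every function s : ℕ → ℕ with s(n) = o(log n), there is no r-local proof-labeling scheme of size s certifying the property AMOS on the class of connected bipartite graphs of diameter at most d in which the n vertices carry distinct identifiers from {1, …, n²}. In particular, certifying AMOS in bipartite (hence also in perfect) graphs of bounded diameter requires certificates of size Ω(log n). -/
open SimpleGraph Filter

/-- A graph is bipartite iff it is 2-colorable. -/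
def Bipartite {V : Type} (G : SimpleGraph V) : Prop := G.Colorable 2

/-! ### Ball isomorphisms from covering maps -/

/-- A hom with the path-lifting property lifts balls. -/
lemma exists_lift_dist_le {V W : Type} {G' : SimpleGraph V} {G : SimpleGraph W}
    (π : V → W) (hlift : ∀ x w, G.Adj (π x) w → ∃ y, G'.Adj x y ∧ π y = w)
    {a b : W} (p : G.Walk a b) :
    ∀ x, π x = a → ∃ (y : V) (q : G'.Walk x y), π y = b ∧ q.length = p.length := by
  induction p with
  | nil => exact fun x hx => ⟨x, .nil, hx, rfl⟩
  | cons h p ih =>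
    rintro x rfl
    obtain ⟨y, hxy, hy⟩ := hlift x _ h
    obtain ⟨z, q, hz, hq⟩ := ih y hy
    exact ⟨z, .cons hxy q, hz, by simp [hq]⟩

/-- A local verifier takes the same decision at a vertex and at its image under a covering map
whose fibres are sparse and which preserves the labels on the ball. -/
lemma IsLocalVerifier.eq_of_cover {r : ℕ} {A : Verifier} (hA : IsLocalVerifier r A)
    (N' N : Network) (P' : Fin N'.n → List Bool) (P : Fin N.n → List Bool)
    (π : Fin N'.n → Fin N.n) (v : Fin N'.n)
    (hhom : ∀ x y, N'.G.Adj x y → N.G.Adj (π x) (π y))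
    (hlift : ∀ x w, N.G.Adj (π x) w → ∃ y, N'.G.Adj x y ∧ π y = w)
    (hinj : ∀ x y, π x = π y → N'.G.dist x y ≤ 2 * r + 1 → x = y)
    (hsel : ∀ x, N'.G.dist v x ≤ r → N'.sel x = N.sel (π x))
    (hids : ∀ x, N'.G.dist v x ≤ r → N'.ids x = N.ids (π x))
    (hcert : ∀ x, N'.G.dist v x ≤ r → P' x = P (π x)) :
    A N' P' v = A N P (π v) := by
  have hmaps : ∀ x : N'.ball r v, π x.1 ∈ N.ball r (π v) := by
    rintro ⟨x, hx⟩
    obtain ⟨p, hp⟩ := N'.conn.exists_walk_length_eq_dist v x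
    let φ : N'.G →g N.G := ⟨π, fun h => hhom _ _ h⟩
    have := SimpleGraph.dist_le (p.map φ)
    rw [SimpleGraph.Walk.length_map, hp] at this
    exact this.trans hx
  have hball : ∀ x y : N'.ball r v, N'.G.dist x.1 y.1 ≤ 2 * r := by
    rintro ⟨x, hx⟩ ⟨y, hy⟩
    have := N'.conn.dist_triangle (u := x) (v := v) (w := y)
    rw [SimpleGraph.dist_comm (u := x) (v := v)] at this
    change N'.G.dist v x ≤ r at hx
    change N'.G.dist v y ≤ r at hy
    change N'.G.dist x y ≤ 2 * r
    omega
  let g : N'.ball r v → N.ball r (π v) := fun x => ⟨π x.1, hmaps x⟩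
  have hg : Function.Bijective g := by
    refine ⟨fun x y hxy => Subtype.ext (hinj _ _ (congrArg Subtype.val hxy) ?_), ?_⟩
    · exact (hball x y).trans (by omega)
    · rintro ⟨w, hw⟩
      obtain ⟨p, hp⟩ := N.conn.exists_walk_length_eq_dist (π v) w
      obtain ⟨y, q, hy, hq⟩ := exists_lift_dist_le π hlift p v rfl
      refine ⟨⟨y, ?_⟩, Subtype.ext hy⟩
      have := SimpleGraph.dist_le q
      rw [hq, hp] at this
      exact this.trans hw
  let φ : N'.G.induce (N'.ball r v) ≃g N.G.induce (N.ball r (π v)) :=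
    { Equiv.ofBijective g hg with
      map_rel_iff' := by
        intro x y
        change N.G.Adj (π x.1) (π y.1) ↔ N'.G.Adj x.1 y.1
        refine ⟨fun h => ?_, hhom _ _⟩
        obtain ⟨z, hz, hzy⟩ := hlift _ _ h
        have h1 := N'.conn.dist_triangle (u := z) (v := x.1) (w := y.1)
        have h2 := hball x y
        have h3 : N'.G.dist z x.1 = 1 := SimpleGraph.dist_eq_one_iff_adj.2 hz.symm
        rw [← hinj z y.1 hzy (by omega)]
        exact hz }
  exact hA N' N P' P v (π v) φ (fun x => hsel x.1 x.2) (fun x => hids x.1 x.2)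
    (fun x => hcert x.1 x.2) rfl

/-! ### Cycles with blown-up hub vertices -/

/-- Vertices of the cycle of length `M` in which every position lying over `0` is replaced by
`f + 1` twins. -/
abbrev HubVertex {M l : ℕ} (c : ZMod M →+* ZMod l) (f : ℕ) : Type :=
  {v : ZMod M × Fin (f + 1) // v.2 = 0 ∨ c v.1 = 0}

namespace HubVertex

variable {M l f : ℕ} {c : ZMod M →+* ZMod l}

/-- The projection onto the vertices of the base cycle. -/
def proj (v : HubVertex c f) : HubVertex (RingHom.id (ZMod l)) f :=
  ⟨(c v.1.1, v.1.2), v.2⟩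

/-- The vertex with twin index `0` at a given position. -/
def ofPos (c : ZMod M →+* ZMod l) (f : ℕ) (p : ZMod M) : HubVertex c f := ⟨(p, 0), .inl rfl⟩

instance [NeZero M] : Finite (HubVertex c f) := Subtype.finite

/-- Numbering of the vertices. -/
noncomputable def equiv [NeZero M] (c : ZMod M →+* ZMod l) (f : ℕ) :
    HubVertex c f ≃ Fin (Nat.card (HubVertex c f)) := Finite.equivFin _

lemma proj_id (v : HubVertex (RingHom.id (ZMod l)) f) : proj v = v := rfl

lemma ext_of_proj {v w : HubVertex c f} (hp : v.1.1 = w.1.1) (h : proj v = proj w) : v = w :=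
  Subtype.ext (Prod.ext hp (congrArg (fun x => x.1.2) h))

end HubVertex

open HubVertex

/-- Adjacency of consecutive positions on the blown-up cycle. -/
def hubGraph {M l : ℕ} [NeZero M] (c : ZMod M →+* ZMod l) (par : ZMod l →+* ZMod 2) (f : ℕ) :
    SimpleGraph (Fin (Nat.card (HubVertex c f))) where
  Adj x y := ((equiv c f).symm y).1.1 = ((equiv c f).symm x).1.1 + 1 ∨
    ((equiv c f).symm x).1.1 = ((equiv c f).symm y).1.1 + 1
  symm := ⟨fun _ _ h => h.symm⟩
  loopless := ⟨fun x h => by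
    have h1 : ((equiv c f).symm x).1.1 = ((equiv c f).symm x).1.1 + 1 := by tauto
    have h2 := congrArg (par.comp c) (left_eq_add.1 h1)
    simp at h2⟩

section HubGraph

variable {M l f : ℕ} [NeZero M] {c : ZMod M →+* ZMod l} {par : ZMod l →+* ZMod 2}

lemma hubGraph_exists_walk (m : ℕ) : ∀ x y : Fin (Nat.card (HubVertex c f)),
    ((equiv c f).symm y).1.1 = ((equiv c f).symm x).1.1 + ((m + 1 : ℕ) : ZMod M) →
    ∃ w : (hubGraph c par f).Walk x y, w.length = m + 1 := by
  induction m with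
  | zero =>
    intro x y h
    exact ⟨.cons (Or.inl (by simpa using h)) .nil, rfl⟩
  | succ m ih =>
    intro x y h
    let z := equiv c f (ofPos c f (((equiv c f).symm x).1.1 + 1))
    have hz : ((equiv c f).symm z).1.1 = ((equiv c f).symm x).1.1 + 1 := by simp [z, ofPos]
    obtain ⟨w, hw⟩ := ih z y (by rw [hz, h]; push_cast; ring)
    have hadj : (hubGraph c par f).Adj x z := Or.inl hz
    exact ⟨.cons hadj w, by rw [SimpleGraph.Walk.length_cons, hw]⟩

lemma hubGraph_exists_short_walk (x y : Fin (Nat.card (HubVertex c f))) :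
    ∃ w : (hubGraph c par f).Walk x y, w.length ≤ 2 * M := by
  let a := (((equiv c f).symm y).1.1 - ((equiv c f).symm x).1.1).val
  have ha : a < M := ZMod.val_lt _
  have hM : 0 < M := Nat.pos_of_neZero M
  obtain ⟨w, hw⟩ := hubGraph_exists_walk (par := par) (a + M - 1) x y (by
    rw [Nat.sub_add_cancel (by omega)]
    simp [a])
  exact ⟨w, by omega⟩

lemma hubGraph_connected : (hubGraph c par f).Connected := by
  have : Nonempty (Fin (Nat.card (HubVertex c f))) := ⟨equiv c f (ofPos c f 0)⟩
  exact ⟨fun x y => ⟨(hubGraph_exists_short_walk x y).choose⟩⟩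

lemma hubGraph_dist_le (x y : Fin (Nat.card (HubVertex c f))) :
    (hubGraph c par f).dist x y ≤ 2 * M := by
  obtain ⟨w, hw⟩ := hubGraph_exists_short_walk (par := par) x y
  exact (SimpleGraph.dist_le w).trans hw

lemma hubGraph_bipartite : Bipartite (hubGraph c par f) := by
  let C : (hubGraph c par f).Coloring (ZMod 2) :=
    SimpleGraph.Coloring.mk (fun x => par (c ((equiv c f).symm x).1.1)) (by
      rintro x y (h | h) <;> simp [h])
  exact C.colorable

lemma hubGraph_walk_shift {x y : Fin (Nat.card (HubVertex c f))}
    (w : (hubGraph c par f).Walk x y) :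
    ∃ z : ℤ, |z| ≤ w.length ∧
      ((equiv c f).symm y).1.1 = ((equiv c f).symm x).1.1 + (z : ZMod M) := by
  induction w with
  | nil => exact ⟨0, by simp⟩
  | cons h w ih =>
    obtain ⟨z, hz, e⟩ := ih
    rw [abs_le] at hz
    rw [SimpleGraph.Walk.length_cons]
    obtain h | h := h
    · refine ⟨z + 1, ?_, by rw [e, h]; push_cast; ring⟩
      rw [abs_le]; push_cast; omega
    · refine ⟨z - 1, ?_, by rw [e, h]; push_cast; ring⟩
      rw [abs_le]; push_cast; omega

lemma hubGraph_shift {x y : Fin (Nat.card (HubVertex c f))} {k : ℕ}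
    (h : (hubGraph c par f).dist x y ≤ k) :
    ∃ z : ℤ, |z| ≤ k ∧
      ((equiv c f).symm y).1.1 = ((equiv c f).symm x).1.1 + (z : ZMod M) := by
  obtain ⟨w, hw⟩ := (hubGraph_connected (par := par)).exists_walk_length_eq_dist x y
  obtain ⟨z, hz, e⟩ := hubGraph_walk_shift w
  exact ⟨z, hz.trans (by exact_mod_cast hw ▸ h), e⟩

end HubGraph

lemma eq_and_eq_of_mul_add_eq {m a b x y : ℕ} (hx : x < m) (hy : y < m)
    (h : a * m + x = b * m + y) : a = b ∧ x = y := by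
  have h1 := congrArg (· % m) h
  simp only [Nat.mul_add_mod', Nat.mod_eq_of_lt hx, Nat.mod_eq_of_lt hy] at h1
  subst h1
  exact ⟨Nat.eq_of_mul_eq_mul_right (by omega) (Nat.add_right_cancel h), rfl⟩

/-- The network on the blown-up cycle whose vertex at position `p` takes its identifier from the
`b p`-th interval of identifiers, and whose selected vertices lie over the twin `0` of the hub. -/
noncomputable def hubNetwork {M l : ℕ} [NeZero M] [NeZero l] (c : ZMod M →+* ZMod l)
    (par : ZMod l →+* ZMod 2) (f : ℕ) (b : ZMod M → ℕ)
    (hb : ∀ p q, c p = c q → b p = b q → p = q) : Network where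
  n := Nat.card (HubVertex c f)
  G := hubGraph c par f
  conn := hubGraph_connected
  sel x := decide (proj ((equiv c f).symm x) = ofPos _ f 0)
  ids x := b ((equiv c f).symm x).1.1 * Nat.card (HubVertex (RingHom.id (ZMod l)) f) +
    equiv (RingHom.id (ZMod l)) f (proj ((equiv c f).symm x)) + 1
  ids_inj x y h := by
    obtain ⟨h2, h1⟩ := eq_and_eq_of_mul_add_eq (Fin.is_lt _) (Fin.is_lt _)
      (Nat.add_right_cancel h)
    have h3 := (equiv (RingHom.id (ZMod l)) f).injective (Fin.ext h1)
    exact (equiv c f).symm.injective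
      (ext_of_proj (hb _ _ (congrArg (fun v => v.1.1) h3) h2) h3)

section HubNetwork

variable {M l f : ℕ} [NeZero M] [NeZero l] {c : ZMod M →+* ZMod l} {par : ZMod l →+* ZMod 2}

lemma hubNetwork_ids_bound (hc : Function.Surjective c) {b : ZMod M → ℕ}
    (hb : ∀ p q, c p = c q → b p = b q → p = q)
    (hlt : ∀ p, b p < Nat.card (HubVertex (RingHom.id (ZMod l)) f))
    (x : Fin (hubNetwork c par f b hb).n) :
    1 ≤ (hubNetwork c par f b hb).ids x ∧
      (hubNetwork c par f b hb).ids x ≤ (hubNetwork c par f b hb).n ^ 2 := by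
  refine ⟨Nat.le_add_left _ _, ?_⟩
  have hn : Nat.card (HubVertex (RingHom.id (ZMod l)) f) ≤ Nat.card (HubVertex c f) := by
    refine Nat.card_le_card_of_surjective (proj (c := c)) ?_
    rintro ⟨⟨p, j⟩, h⟩
    obtain ⟨q, rfl⟩ := hc p
    exact ⟨⟨(q, j), h⟩, rfl⟩
  refine le_trans ?_ (Nat.pow_le_pow_left hn 2)
  have h1 := hlt ((equiv c f).symm x).1.1
  have h2 := (equiv (RingHom.id (ZMod l)) f (proj ((equiv c f).symm x))).2
  change b ((equiv c f).symm x).1.1 * _ + (equiv (RingHom.id (ZMod l)) f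
    (proj ((equiv c f).symm x)) : ℕ) + 1 ≤ _
  nlinarith

end HubNetwork

/-! ### Finding two rows and two columns of one colour -/

lemma exists_monochromatic_rectangle {n : ℕ} {κ : Type} [Finite κ] (col : Fin n → Fin n → κ)
    (h : (Nat.card κ + 1) ^ 2 * Nat.card κ < n) :
    ∃ i₀ i₁ k₀ k₁, i₀ ≠ i₁ ∧ k₀ ≠ k₁ ∧
      ∃ a, ∀ i k, (i = i₀ ∨ i = i₁) → (k = k₀ ∨ k = k₁) → col i k = a := by
  have := Fintype.ofFinite κ
  rw [Nat.card_eq_fintype_card] at h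
  set C := Fintype.card κ with hC
  have hn : 0 < n := by omega
  have hC0 : 0 < C := Fintype.card_pos_iff.2 ⟨col ⟨0, hn⟩ ⟨0, hn⟩⟩
  have hle : C + 1 ≤ n := by nlinarith
  have key : ∀ i, ∃ t : Fin (C + 1) × Fin (C + 1), t.1 ≠ t.2 ∧
      col i (t.1.castLE hle) = col i (t.2.castLE hle) := by
    intro i
    obtain ⟨a, b, hab, e⟩ := Fintype.exists_ne_map_eq_of_card_lt
      (fun a : Fin (C + 1) => col i (a.castLE hle)) (by simp [hC])
    exact ⟨(a, b), hab, e⟩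
  choose t ht hcol using key
  obtain ⟨i₀, i₁, hi, e⟩ := Fintype.exists_ne_map_eq_of_card_lt
    (fun i => (t i, col i ((t i).1.castLE hle))) (by
      simp only [Fintype.card_prod, Fintype.card_fin, ← hC]
      calc _ = (C + 1) ^ 2 * C := by ring
        _ < n := h)
  simp only [Prod.mk.injEq] at e
  obtain ⟨e1, e2⟩ := e
  refine ⟨i₀, i₁, (t i₀).1.castLE hle, (t i₀).2.castLE hle, hi,
    fun h => ht i₀ (Fin.castLE_injective hle h), col i₀ ((t i₀).1.castLE hle), ?_⟩
  rintro i k (rfl | rfl) (rfl | rfl)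
  · rfl
  · exact (hcol _).symm
  · rw [e2, e1]
  · rw [e2, e1, hcol]

/-- Bit strings of length at most `s` are determined by their first `s` entries. -/
lemma List.eq_of_getElem?_fin_eq {s : ℕ} {l₁ l₂ : List Bool} (h₁ : l₁.length ≤ s)
    (h₂ : l₂.length ≤ s) (h : (fun i : Fin s => l₁[(i : ℕ)]?) = fun i : Fin s => l₂[(i : ℕ)]?) :
    l₁ = l₂ := by
  refine List.ext_getElem? fun i => ?_
  by_cases hi : i < s
  · exact congrFun h ⟨i, hi⟩
  · rw [List.getElem?_eq_none (by omega), List.getElem?_eq_none (by omega)]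

/-- If `s = o(log n)` then `n` eventually exceeds any fixed power of `3 ^ s`. -/
lemma exists_colour_bound {s : ℕ → ℕ}
    (hs : (fun n : ℕ => (s n : ℝ)) =o[atTop] fun n : ℕ => Real.log n) (q : ℕ) :
    ∃ n₀, ∀ n ≥ n₀, (3 ^ (q * s n) + 1) ^ 2 * 3 ^ (q * s n) < n := by
  have hpos : (0 : ℝ) < 1 / (4 * q * Real.log 3 + 1) := by
    have : 0 ≤ Real.log 3 := Real.log_nonneg (by norm_num)
    positivity
  obtain ⟨n₁, h₁⟩ := eventually_atTop.1 (hs.bound hpos)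
  refine ⟨max n₁ 257, fun n hn => ?_⟩
  have hn1 : n₁ ≤ n := (le_max_left _ _).trans hn
  have hn2 : 257 ≤ n := (le_max_right _ _).trans hn
  have hbd := h₁ n hn1
  have hlog3 : 0 ≤ Real.log 3 := Real.log_nonneg (by norm_num)
  have hnr : (1 : ℝ) ≤ n := by exact_mod_cast (by omega : 1 ≤ n)
  rw [Real.norm_of_nonneg (by positivity), Real.norm_of_nonneg (Real.log_nonneg hnr),
    one_div, inv_mul_eq_div, le_div_iff₀ (by positivity)] at hbd
  have hpow : (3 ^ (q * s n)) ^ 4 ≤ n := by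
    have : ((3 : ℝ) ^ (q * s n)) ^ 4 ≤ n := by
      rw [← Real.log_le_log_iff (by positivity) (by linarith), Real.log_pow, Real.log_pow]
      push_cast
      have : (0 : ℝ) ≤ s n := by positivity
      nlinarith
    exact_mod_cast this
  set C := 3 ^ (q * s n) with hC
  have hC1 : 1 ≤ C := Nat.one_le_pow _ _ (by norm_num)
  have h4 : (C + 1) ^ 2 * C ≤ 4 * C ^ 3 := by
    have : (C + 1) ^ 2 ≤ 4 * C ^ 2 := by nlinarith
    nlinarith
  by_cases h5 : C ≤ 4
  · have : C ^ 3 ≤ 4 ^ 3 := Nat.pow_le_pow_left h5 3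
    omega
  · have : 0 < C ^ 3 := by positivity
    have : 5 * C ^ 3 ≤ C ^ 4 := by
      rw [pow_succ C 3, mul_comm]; exact Nat.mul_le_mul_left _ (by omega)
    omega

/-! ### Positions on the cycle and on its double cover -/

lemma ZMod.val_add_intCast {M : ℕ} [NeZero M] {p q : ZMod M} {z : ℤ} (h : q = p + (z : ZMod M))
    (hz : |z| < M) :
    (q.val : ℤ) = p.val + z ∨ (q.val : ℤ) = p.val + z + M ∨ (q.val : ℤ) = p.val + z - M := by
  have h1 : (((q.val : ℤ) - p.val - z : ℤ) : ZMod M) = 0 := by simp [h]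
  rw [ZMod.intCast_zmod_eq_zero_iff_dvd] at h1
  obtain ⟨t, ht⟩ := h1
  have hp := ZMod.val_lt p
  have hq := ZMod.val_lt q
  rw [abs_lt] at hz
  have h3 : t < 2 := by by_contra! hh; nlinarith
  have h4 : -2 < t := by by_contra! hh; nlinarith
  have : t = -1 ∨ t = 0 ∨ t = 1 := by omega
  obtain rfl | rfl | rfl := this <;> omega

lemma ZMod.val_castHom_of_double {K : ℕ} [NeZero K] (h : 4 * K ∣ 8 * K) (p : ZMod (8 * K)) :
    (ZMod.castHom h (ZMod (4 * K)) p).val = p.val ∧ p.val < 4 * K ∨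
    (ZMod.castHom h (ZMod (4 * K)) p).val + 4 * K = p.val ∧ 4 * K ≤ p.val := by
  have hp := ZMod.val_lt p
  have : (ZMod.castHom h (ZMod (4 * K)) p).val = p.val % (4 * K) := by
    rw [ZMod.castHom_apply, ZMod.cast_eq_val, ZMod.val_natCast]
  rw [this]
  by_cases hlt : p.val < 4 * K
  · exact .inl ⟨Nat.mod_eq_of_lt hlt, hlt⟩
  · right
    rw [Nat.mod_eq_sub_mod (by omega), Nat.mod_eq_of_lt (by omega)]
    omega

/-- Interval indices on the base cycle: block `i` followed by block `k`. -/
def baseBlock (K i k : ℕ) (p : ZMod (4 * K)) : ℕ := if p.val < 2 * K then i else k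

/-- Interval indices on the double cover: blocks `i₀`, `k₀`, `i₁`, `k₁` in cyclic order. -/
def coverBlock (K i₀ k₀ i₁ k₁ : ℕ) (p : ZMod (8 * K)) : ℕ :=
  if p.val < 2 * K then i₀ else if p.val < 4 * K then k₀ else if p.val < 6 * K then i₁ else k₁

/-- The block of the first kind closest to a position of the double cover. -/
def nearFirst {α : Type} (K : ℕ) (i₀ i₁ : α) (p : ZMod (8 * K)) : α :=
  if p.val < 3 * K ∨ 7 * K ≤ p.val then i₀ else i₁

/-- The block of the second kind closest to a position of the double cover. -/
def nearSecond {α : Type} (K : ℕ) (k₀ k₁ : α) (p : ZMod (8 * K)) : α :=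
  if K ≤ p.val ∧ p.val < 5 * K then k₀ else k₁

section Blocks

variable {K : ℕ} [NeZero K]

lemma coverBlock_injOn_fibre (h : 4 * K ∣ 8 * K) {i₀ k₀ i₁ k₁ : ℕ} (hi : i₀ ≠ i₁) (hk : k₀ ≠ k₁)
    (p q : ZMod (8 * K))
    (hpq : ZMod.castHom h (ZMod (4 * K)) p = ZMod.castHom h (ZMod (4 * K)) q)
    (hb : coverBlock K i₀ k₀ i₁ k₁ p = coverBlock K i₀ k₀ i₁ k₁ q) : p = q := by
  apply ZMod.val_injective
  have hp := ZMod.val_castHom_of_double h p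
  have hq := ZMod.val_castHom_of_double h q
  have hpl := ZMod.val_lt p
  have hql := ZMod.val_lt q
  rw [hpq] at hp
  have hr := ZMod.val_lt (ZMod.castHom h (ZMod (4 * K)) q)
  unfold coverBlock at hb
  split_ifs at hb <;> omega

lemma coverBlock_eq_baseBlock (h : 4 * K ∣ 8 * K) (i₀ k₀ i₁ k₁ : ℕ) {p q : ZMod (8 * K)} {z : ℤ}
    (hq : q = p + (z : ZMod (8 * K))) (hz : |z| < K) :
    coverBlock K i₀ k₀ i₁ k₁ q = baseBlock K (nearFirst K i₀ i₁ p) (nearSecond K k₀ k₁ p)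
      (ZMod.castHom h (ZMod (4 * K)) q) := by
  have h1 := ZMod.val_add_intCast hq (by push_cast; omega)
  have h2 := ZMod.val_castHom_of_double h q
  have hpl := ZMod.val_lt p
  have hql := ZMod.val_lt q
  rw [abs_lt] at hz
  push_cast at h1
  unfold coverBlock baseBlock nearFirst nearSecond
  split_ifs <;> omega

lemma near_eq_of_hub {α : Type} (h : 4 * K ∣ 8 * K) (i₀ k₀ i₁ k₁ : α) {p q : ZMod (8 * K)} {z : ℤ}
    (hq : q = p + (z : ZMod (8 * K))) (hz : |z| < K)
    (h0 : ZMod.castHom h (ZMod (4 * K)) q = 0) :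
    nearFirst K i₀ i₁ q = nearFirst K i₀ i₁ p ∧ nearSecond K k₀ k₁ q = nearSecond K k₀ k₁ p := by
  have h1 := ZMod.val_add_intCast hq (by push_cast; omega)
  have h2 := ZMod.val_castHom_of_double h q
  have hpl := ZMod.val_lt p
  have hql := ZMod.val_lt q
  rw [abs_lt] at hz
  rw [h0, ZMod.val_zero] at h2
  push_cast at h1
  unfold nearFirst nearSecond
  constructor <;> split_ifs <;> first | rfl | omega

end Blocks

lemma eq_of_shift_of_castHom_eq {K : ℕ} (h : 4 * K ∣ 8 * K) {p q : ZMod (8 * K)} {z : ℤ}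
    (hq : q = p + (z : ZMod (8 * K))) (hz : |z| < 4 * K)
    (h0 : ZMod.castHom h (ZMod (4 * K)) p = ZMod.castHom h (ZMod (4 * K)) q) : p = q := by
  rw [hq, map_add, map_intCast, left_eq_add, ZMod.intCast_zmod_eq_zero_iff_dvd] at h0
  have : z = 0 := Int.eq_zero_of_abs_lt_dvd h0 (by push_cast; exact hz)
  simp [hq, this]


/-- Certifying AMOS in bipartite graphs of bounded diameter requires certificates
of size `Ω(log n)`: for every `r ≥ 1` there is a constant `d` such that no
`r`-local proof-labeling scheme of size `o(log n)` certifies AMOS on connected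
bipartite graphs of diameter at most `d` whose `n` vertices carry distinct
identifiers from `{1, …, n²}`. -/
theorem amos_lower_bound_bipartite_bounded_diameter (r : ℕ) (hr : 1 ≤ r) :
    ∃ d : ℕ, ∀ s : ℕ → ℕ,
      ((fun n : ℕ => (s n : ℝ)) =o[atTop] fun n : ℕ => Real.log n) →
      IsEmpty (PLS r s
        (fun N => Bipartite N.G ∧ (∀ u v : Fin N.n, N.G.dist u v ≤ d) ∧
          (∀ v : Fin N.n, 1 ≤ N.ids v ∧ N.ids v ≤ N.n ^ 2))
        Network.AMOS) := by
  have : NeZero (r + 1) := ⟨by omega⟩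
  set K := r + 1 with hK
  have hdvd : 4 * K ∣ 8 * K := ⟨2, by ring⟩
  let par : ZMod (4 * K) →+* ZMod 2 := ZMod.castHom ⟨2 * K, by ring⟩ _
  let c := ZMod.castHom hdvd (ZMod (4 * K))
  have hc : Function.Surjective c := ZMod.castHom_surjective hdvd
  refine ⟨16 * K, fun s hs => ⟨fun S => ?_⟩⟩
  obtain ⟨f, hf⟩ := exists_colour_bound hs (4 * K)
  set n := Nat.card (HubVertex (RingHom.id (ZMod (4 * K))) f)
  have hfn : f ≤ n := by
    have := Nat.card_le_card_of_injective
      (fun j : Fin (f + 1) => (⟨(0, j), .inr rfl⟩ : HubVertex (RingHom.id (ZMod (4 * K))) f))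
      (fun a b h => congrArg (fun v => v.1.2) h)
    rw [Nat.card_fin] at this
    exact (Nat.le_succ f).trans this
  let e := equiv (RingHom.id (ZMod (4 * K))) f
  let N : Fin n → Fin n → Network := fun i k =>
    hubNetwork (RingHom.id (ZMod (4 * K))) par f (baseBlock K i k) (fun _ _ h _ => h)
  have hnet : ∀ i k, Bipartite (N i k).G ∧ (∀ u v, (N i k).G.dist u v ≤ 16 * K) ∧
      (∀ v, 1 ≤ (N i k).ids v ∧ (N i k).ids v ≤ (N i k).n ^ 2) := by
    refine fun i k => ⟨hubGraph_bipartite (par := par), fun u v => (hubGraph_dist_le (par := par) u v).trans (by omega),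
      hubNetwork_ids_bound Function.surjective_id _ fun p => ?_⟩
    unfold baseBlock
    split_ifs
    exacts [i.2, k.2]
  have hamos : ∀ i k, (N i k).AMOS := by
    intro i k u v hu hv
    have hu' : proj (e.symm u) = ofPos _ f 0 := of_decide_eq_true hu
    have hv' : proj (e.symm v) = ofPos _ f 0 := of_decide_eq_true hv
    rw [proj_id] at hu' hv'
    exact e.symm.injective (hu'.trans hv'.symm)
  let Q : Fin n → Fin n → HubVertex (RingHom.id (ZMod (4 * K))) f → List Bool :=
    fun i k x => S.prover (N i k) (e x)
  obtain ⟨i₀, i₁, k₀, k₁, hi, hk, a, ha⟩ := exists_monochromatic_rectangle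
    (fun i k (p : ZMod (4 * K)) (t : Fin (s n)) => (Q i k (ofPos _ f p))[(t : ℕ)]?) (by
      have hcard : Nat.card (ZMod (4 * K) → Fin (s n) → Option Bool) = 3 ^ (4 * K * s n) := by
        rw [Nat.card_fun, Nat.card_fun, Nat.card_zmod, Nat.card_fin, ← pow_mul,
          mul_comm (s n)]
        simp
      rw [hcard]
      exact hf n hfn)
  have hQ : ∀ {i k i' k'}, (i = i₀ ∨ i = i₁) → (k = k₀ ∨ k = k₁) → (i' = i₀ ∨ i' = i₁) →
      (k' = k₀ ∨ k' = k₁) → ∀ p, Q i k (ofPos _ f p) = Q i' k' (ofPos _ f p) := by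
    intro i k i' k' h1 h2 h3 h4 p
    exact List.eq_of_getElem?_fin_eq (S.prover_size (N i k) (hnet i k) (hamos i k) _)
      (S.prover_size (N i' k') (hnet i' k') (hamos i' k') _)
      (congrFun ((ha i k h1 h2).trans (ha i' k' h3 h4).symm) p)
  let N' : Network := hubNetwork c par f (coverBlock K i₀ k₀ i₁ k₁)
    (coverBlock_injOn_fibre hdvd (Fin.val_ne_of_ne hi) (Fin.val_ne_of_ne hk))
  let e' := equiv c f
  have hnet' : Bipartite N'.G ∧ (∀ u v, N'.G.dist u v ≤ 16 * K) ∧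
      (∀ v, 1 ≤ N'.ids v ∧ N'.ids v ≤ N'.n ^ 2) := by
    refine ⟨hubGraph_bipartite (par := par), fun u v => (hubGraph_dist_le (par := par) u v).trans (by omega),
      hubNetwork_ids_bound hc _ fun p => ?_⟩
    unfold coverBlock
    split_ifs
    exacts [i₀.2, k₀.2, i₁.2, k₁.2]
  have hamos' : ¬ N'.AMOS := by
    intro h
    have hzero : c ((4 * K : ℕ) : ZMod (8 * K)) = 0 := by
      rw [map_natCast, ZMod.natCast_self]
    have h1 := h (e' (ofPos c f 0)) (e' (ofPos c f ((4 * K : ℕ) : ZMod (8 * K))))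
      (decide_eq_true (by simp [e', proj, ofPos]))
      (decide_eq_true (by simp only [e', Equiv.symm_apply_apply, proj, ofPos, hzero]))
    have h2 := congrArg (fun v => v.1.1.val) (e'.injective h1)
    simp only [ofPos, ZMod.val_zero, ZMod.val_natCast] at h2
    rw [Nat.mod_eq_of_lt (by omega)] at h2
    omega
  let I : ZMod (8 * K) → Fin n := nearFirst K i₀ i₁
  let J : ZMod (8 * K) → Fin n := nearSecond K k₀ k₁
  have hI : ∀ p, I p = i₀ ∨ I p = i₁ := fun p => by
    simp only [I, nearFirst]; split_ifs <;> simp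
  have hJ : ∀ p, J p = k₀ ∨ J p = k₁ := fun p => by
    simp only [J, nearSecond]; split_ifs <;> simp
  have hIv : ∀ p, ((I p : Fin n) : ℕ) = nearFirst K (i₀ : ℕ) i₁ p := fun p =>
    apply_ite Fin.val _ _ _
  have hJv : ∀ p, ((J p : Fin n) : ℕ) = nearSecond K (k₀ : ℕ) k₁ p := fun p =>
    apply_ite Fin.val _ _ _
  let P' : Fin N'.n → List Bool := fun x =>
    Q (I (e'.symm x).1.1) (J (e'.symm x).1.1) (proj (e'.symm x))
  obtain ⟨v, hv⟩ := S.soundness N' hnet' hamos' P'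
  set p := (e'.symm v).1.1 with hp
  have hacc := S.completeness (N (I p) (J p)) (hnet _ _) (hamos _ _) (e (proj (e'.symm v)))
  suffices h : S.verifier N' P' v =
      S.verifier (N (I p) (J p)) (S.prover (N (I p) (J p))) (e (proj (e'.symm v))) from
    Bool.false_ne_true (hv.symm.trans (h.trans hacc))
  have shift : ∀ {x y : Fin N'.n} {m : ℕ}, N'.G.dist x y ≤ m →
      ∃ z : ℤ, |z| ≤ m ∧ (e'.symm y).1.1 = (e'.symm x).1.1 + (z : ZMod (8 * K)) :=
    fun h => hubGraph_shift (par := par) h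
  refine S.verifier_local.eq_of_cover N' (N (I p) (J p)) P' _ (fun x => e (proj (e'.symm x))) v
    ?_ ?_ ?_ ?_ ?_ ?_
  · rintro x y (h | h)
    · left
      simp only [e, Equiv.symm_apply_apply, proj]
      exact (congrArg c h).trans ((map_add c _ _).trans (congrArg _ (map_one c)))
    · right
      simp only [e, Equiv.symm_apply_apply, proj]
      exact (congrArg c h).trans ((map_add c _ _).trans (congrArg _ (map_one c)))
  · intro x w hw
    have hw' : (e.symm w).1.1 = c (e'.symm x).1.1 + 1 ∨
        c (e'.symm x).1.1 = (e.symm w).1.1 + 1 := by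
      obtain h | h := hw
      · left; exact h.trans (by simp [e, proj])
      · right; exact Eq.trans (by simp [e, proj]) h
    have lift : ∀ q : ZMod (8 * K), c q = (e.symm w).1.1 →
        ∃ y : HubVertex c f, y.1.1 = q ∧ proj y = e.symm w := by
      intro q hq
      refine ⟨⟨(q, (e.symm w).1.2), ?_⟩, rfl, Subtype.ext (Prod.ext hq rfl)⟩
      rw [hq]
      exact (e.symm w).2
    obtain h | h := hw'
    · obtain ⟨y, hy, hyw⟩ := lift ((e'.symm x).1.1 + 1) (by rw [map_add, map_one, h])
      refine ⟨e' y, Or.inl ?_,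
        (congrArg e ((congrArg proj (e'.symm_apply_apply y)).trans hyw)).trans
          (e.apply_symm_apply w)⟩
      exact Eq.trans (by simp [e']) hy
    · obtain ⟨y, hy, hyw⟩ := lift ((e'.symm x).1.1 - 1) (by rw [map_sub, map_one, h]; ring)
      refine ⟨e' y, Or.inr ?_,
        (congrArg e ((congrArg proj (e'.symm_apply_apply y)).trans hyw)).trans
          (e.apply_symm_apply w)⟩
      change (e'.symm x).1.1 = (e'.symm (e' y)).1.1 + 1
      rw [Equiv.symm_apply_apply, hy]
      ring
  · intro x y hxy hd
    have hxy' := e.injective hxy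
    obtain ⟨z, hz, hzy⟩ := shift hd
    refine e'.symm.injective (ext_of_proj (eq_of_shift_of_castHom_eq hdvd hzy ?_
      (congrArg (fun v => v.1.1) hxy')) hxy')
    push_cast at hz ⊢
    omega
  · intro x _
    change decide (proj (e'.symm x) = _) = decide (proj (e.symm (e (proj (e'.symm x)))) = _)
    rw [Equiv.symm_apply_apply, proj_id]
  · intro x hx
    obtain ⟨z, hz, hzx⟩ := shift hx
    have := coverBlock_eq_baseBlock hdvd i₀ k₀ i₁ k₁ hzx (by omega)
    change coverBlock K i₀ k₀ i₁ k₁ (e'.symm x).1.1 * n + (e (proj (e'.symm x)) : ℕ) + 1 =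
      baseBlock K (I p) (J p) (e.symm (e (proj (e'.symm x)))).1.1 * n +
        (e (proj (e.symm (e (proj (e'.symm x))))) : ℕ) + 1
    rw [Equiv.symm_apply_apply, proj_id, this, hIv, hJv]
    rfl
  · intro x hx
    obtain ⟨z, hz, hzx⟩ := shift hx
    change Q (I (e'.symm x).1.1) (J (e'.symm x).1.1) (proj (e'.symm x)) =
      Q (I p) (J p) (proj (e'.symm x))
    obtain h0 | h0 := (e'.symm x).2
    · have : proj (e'.symm x) = ofPos _ f (c (e'.symm x).1.1) := Subtype.ext (Prod.ext rfl h0)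
      rw [this]
      exact hQ (hI _) (hJ _) (hI _) (hJ _) _
    · obtain ⟨h1, h2⟩ := near_eq_of_hub hdvd i₀ k₀ i₁ k₁ hzx (by omega) h0
      simp only [I, J, hp]
      rw [h1, h2]
end

section
/- For every integer r ≥ 1 there exist constants d and t depending only on r such that, for every function s : ℕ → ℕ with s(n) = o(log n), there is no r-local proof-labeling scheme of size s certifying the property AMOS on the class of connected graphs of diameter at most d and neighborhood diversity at most t in which the n vertices carry distinct identifiers from {1, …, n²}. In other words, certifying AMOS in graphs with bounded neighborhood diversity requires certificates of size Ω(log n). -/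
open SimpleGraph Filter

/-- Two vertices `u`, `v` are twins if `N(u) \ {u,v} = N(v) \ {u,v}`. -/
def Twins {V : Type} (G : SimpleGraph V) (u v : V) : Prop :=
  G.neighborSet u \ {u, v} = G.neighborSet v \ {u, v}

/-- A graph has neighborhood diversity at most `t` if its vertex set can be
partitioned into at most `t` classes of pairwise twin vertices. -/
def NeighborhoodDiversityLE {V : Type} (G : SimpleGraph V) (t : ℕ) : Prop :=
  ∃ f : V → Fin t, ∀ u v : V, f u = f v → Twins G u v

/-! ### Blow-ups of cycles -/

/-- The blow-up of a cycle of length `K`: vertices carry a position in `{0, …, K - 1}`, and are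
adjacent when their positions are cyclically consecutive. -/
def cycleBlowup {V : Type} (K : ℕ) (pos : V → ℕ) : SimpleGraph V where
  Adj x y := pos x ≠ pos y ∧ (pos x = pos y + 1 ∨ pos y = pos x + 1 ∨
    (pos x = 0 ∧ pos y + 1 = K) ∨ (pos y = 0 ∧ pos x + 1 = K))
  symm := ⟨fun x y h => by grind⟩
  loopless := ⟨fun x h => h.1 rfl⟩

section cycleBlowup

variable {V : Type} {K : ℕ} {pos : V → ℕ}

lemma cycleBlowup_adj {x y : V} : (cycleBlowup K pos).Adj x y ↔
    pos x ≠ pos y ∧ (pos x = pos y + 1 ∨ pos y = pos x + 1 ∨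
      (pos x = 0 ∧ pos y + 1 = K) ∨ (pos y = 0 ∧ pos x + 1 = K)) := Iff.rfl

lemma cycleBlowup_exists_walk (hK : 2 ≤ K) (hlt : ∀ x, pos x < K)
    (hsurj : ∀ p < K, ∃ x, pos x = p) (x : V) (j : ℕ) :
    ∀ y, (pos y = pos x + (j + 1) ∨ pos y + K = pos x + (j + 1)) →
      ∃ w : (cycleBlowup K pos).Walk x y, w.length = j + 1 := by
  induction j with
  | zero =>
    intro y hy
    have hx := hlt x
    have hy' := hlt y
    exact ⟨Walk.cons (cycleBlowup_adj.2 (by omega)) Walk.nil, rfl⟩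
  | succ j ih =>
    intro y hy
    have hx := hlt x
    have hy' := hlt y
    obtain ⟨z, hz⟩ := hsurj (if pos y = 0 then K - 1 else pos y - 1) (by split_ifs <;> omega)
    obtain ⟨w, hw⟩ := ih z (by split_ifs at hz <;> omega)
    refine ⟨w.concat (cycleBlowup_adj.2 (by split_ifs at hz <;> omega)), ?_⟩
    rw [Walk.length_concat, hw]

lemma cycleBlowup_exists_walk_length_le (hK : 2 ≤ K) (hlt : ∀ x, pos x < K)
    (hsurj : ∀ p < K, ∃ x, pos x = p) (x y : V) :
    ∃ w : (cycleBlowup K pos).Walk x y, w.length ≤ K := by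
  have hx := hlt x
  have hy := hlt y
  by_cases h : pos x < pos y
  · obtain ⟨w, hw⟩ := cycleBlowup_exists_walk hK hlt hsurj x (pos y - pos x - 1) y (by omega)
    exact ⟨w, by omega⟩
  · obtain ⟨w, hw⟩ := cycleBlowup_exists_walk hK hlt hsurj x (pos y + K - pos x - 1) y (by omega)
    exact ⟨w, by omega⟩

lemma cycleBlowup_connected [Nonempty V] (hK : 2 ≤ K) (hlt : ∀ x, pos x < K)
    (hsurj : ∀ p < K, ∃ x, pos x = p) : (cycleBlowup K pos).Connected :=
  ⟨fun x y => (cycleBlowup_exists_walk_length_le hK hlt hsurj x y).elim fun w _ => w.reachable⟩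

lemma cycleBlowup_dist_le (hK : 2 ≤ K) (hlt : ∀ x, pos x < K)
    (hsurj : ∀ p < K, ∃ x, pos x = p) (x y : V) : (cycleBlowup K pos).dist x y ≤ K := by
  obtain ⟨w, hw⟩ := cycleBlowup_exists_walk_length_le hK hlt hsurj x y
  exact (dist_le w).trans hw

lemma cycleBlowup_neighborhoodDiversityLE {t : ℕ} (hlt : ∀ x, pos x < t) :
    NeighborhoodDiversityLE (cycleBlowup K pos) t := by
  refine ⟨fun x => ⟨pos x, hlt x⟩, fun u v h => ?_⟩
  have h' : pos u = pos v := congrArg Fin.val h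
  have hN : (cycleBlowup K pos).neighborSet u = (cycleBlowup K pos).neighborSet v := by
    ext y
    simp only [mem_neighborSet, cycleBlowup_adj, h']
  rw [Twins, hN]

/-- Positions are cyclically within the length of a walk. -/
lemma cycleBlowup_pos_of_walk (hlt : ∀ x, pos x < K) {x y : V}
    (w : (cycleBlowup K pos).Walk x y) :
    (pos x ≤ pos y + w.length ∧ pos y ≤ pos x + w.length) ∨
      pos x + K ≤ pos y + w.length ∨ pos y + K ≤ pos x + w.length := by
  induction w with
  | nil => simp
  | @cons a b c h w ih =>
    have ha := hlt a
    have hb := hlt b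
    have hc := hlt c
    rw [cycleBlowup_adj] at h
    rw [Walk.length_cons]
    omega

end cycleBlowup

/-! ### Local isomorphisms along covering maps -/

lemma exists_walk_lift {V W : Type} {G : SimpleGraph V} {H : SimpleGraph W} (σ : V → W)
    (hlift : ∀ u y, H.Adj (σ u) y → ∃ w, G.Adj u w ∧ σ w = y) {x y : W} (p : H.Walk x y) :
    ∀ u, σ u = x → ∃ w, σ w = y ∧ ∃ q : G.Walk u w, q.length = p.length := by
  induction p with
  | nil => exact fun u hu => ⟨u, hu, Walk.nil, rfl⟩
  | cons h p ih =>
    rintro u rfl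
    obtain ⟨z, hz, hσ⟩ := hlift u _ h
    obtain ⟨w, hw, q, hq⟩ := ih z hσ
    exact ⟨w, hw, Walk.cons hz q, by simp [hq]⟩

/-- A locally surjective homomorphism that is injective and reflects adjacency on a ball restricts
to an isomorphism onto the ball around the image of the center. -/
lemma Network.exists_ball_iso {N M : Network} (σ : Fin N.n → Fin M.n)
    (hhom : ∀ u w, N.G.Adj u w → M.G.Adj (σ u) (σ w))
    (hlift : ∀ u y, M.G.Adj (σ u) y → ∃ w, N.G.Adj u w ∧ σ w = y) (r : ℕ) (v : Fin N.n)
    (hinj : ∀ u ∈ N.ball r v, ∀ w ∈ N.ball r v, σ u = σ w → u = w)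
    (hrefl : ∀ u ∈ N.ball r v, ∀ w ∈ N.ball r v, M.G.Adj (σ u) (σ w) → N.G.Adj u w) :
    ∃ φ : N.G.induce (N.ball r v) ≃g M.G.induce (M.ball r (σ v)),
      ∀ x : N.ball r v, (φ x).1 = σ x.1 := by
  have hmem : ∀ u ∈ N.ball r v, σ u ∈ M.ball r (σ v) := fun u hu => by
    obtain ⟨w, hw⟩ := N.conn.exists_walk_length_eq_dist v u
    have h := dist_le (w.map ⟨σ, hhom _ _⟩)
    rw [Walk.length_map, hw] at h
    exact h.trans hu
  let f : N.ball r v → M.ball r (σ v) := fun x => ⟨σ x.1, hmem x.1 x.2⟩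
  have hf : Function.Bijective f := by
    refine ⟨fun x y h => Subtype.ext (hinj _ x.2 _ y.2 (congrArg Subtype.val h)), fun y => ?_⟩
    obtain ⟨p, hp⟩ := M.conn.exists_walk_length_eq_dist (σ v) y.1
    obtain ⟨w, hw, q, hq⟩ := exists_walk_lift σ hlift p v rfl
    have hwm : w ∈ N.ball r v := (dist_le q).trans (by rw [hq, hp]; exact y.2)
    exact ⟨⟨w, hwm⟩, Subtype.ext hw⟩
  exact ⟨⟨Equiv.ofBijective f hf, fun {x y} =>
    ⟨fun h => hrefl _ x.2 _ y.2 h, fun h => hhom _ _ h⟩⟩, fun x => rfl⟩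

/-! ### The networks -/

/-- Position of a vertex in a cycle of length `4 * r + 1`; the last position is blown up. -/
def basePos (r : ℕ) {n : ℕ} (x : Fin n) : ℕ := min x.val (4 * r)

/-- Identifiers: vertices of index below `2 * r` use the block `b`, the others the block `a`. -/
def blockId (r : ℕ) {n : ℕ} (a b : Fin n) (x : Fin n) : ℕ :=
  1 + (x.val + n * (if x.val < 2 * r then b else a : Fin n).val)

lemma blockId_inj {r n : ℕ} {a b a' b' x y : Fin n} (h : blockId r a b x = blockId r a' b' y) :
    x = y ∧ (if x.val < 2 * r then b else a) = (if y.val < 2 * r then b' else a') := by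
  have hn : 0 < n := x.pos
  have h := Nat.add_left_cancel h
  have hmod := congrArg (· % n) h
  have hdiv := congrArg (· / n) h
  simp only [Nat.add_mul_mod_self_left, Nat.mod_eq_of_lt x.isLt, Nat.mod_eq_of_lt y.isLt] at hmod
  simp only [Nat.add_mul_div_left _ _ hn, Nat.div_eq_of_lt x.isLt, Nat.div_eq_of_lt y.isLt,
    zero_add] at hdiv
  exact ⟨Fin.ext hmod, Fin.ext hdiv⟩

lemma one_le_blockId {r n : ℕ} (a b x : Fin n) : 1 ≤ blockId r a b x := Nat.le_add_right _ _

lemma blockId_le {r n : ℕ} (a b x : Fin n) : blockId r a b x ≤ n ^ 2 := by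
  have hx := x.isLt
  have hc := (if x.val < 2 * r then b else a).isLt
  unfold blockId
  nlinarith

lemma basePos_lt (r : ℕ) {n : ℕ} (x : Fin n) : basePos r x < 4 * r + 1 := by
  unfold basePos
  omega

lemma basePos_surj {r n : ℕ} (hn : 4 * r + 1 ≤ n) (p : ℕ) (hp : p < 4 * r + 1) :
    ∃ x : Fin n, basePos r x = p :=
  ⟨⟨p, by omega⟩, by unfold basePos; simp only; omega⟩

/-- A blown-up cycle with one selected vertex. -/
def baseNet (r n : ℕ) (hr : 1 ≤ r) (hn : 4 * r + 1 ≤ n) (a b : Fin n) : Network where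
  n := n
  G := cycleBlowup (4 * r + 1) (basePos r)
  conn :=
    haveI : Nonempty (Fin n) := ⟨a⟩
    cycleBlowup_connected (by omega) (basePos_lt r) (basePos_surj hn)
  sel x := decide (x.val = 0)
  ids := blockId r a b
  ids_inj _ _ h := (blockId_inj h).1

/-- Index of the vertex of the base network below a vertex of its double cover. -/
def proj {n : ℕ} (u : Fin (n * 2)) : Fin n := (finProdFinEquiv.symm u).1

/-- Sheet of a vertex of the double cover. -/
def sheet {n : ℕ} (u : Fin (n * 2)) : Fin 2 := (finProdFinEquiv.symm u).2

lemma ext_proj_sheet {n : ℕ} {u w : Fin (n * 2)} (h : proj u = proj w) (h' : sheet u = sheet w) :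
    u = w :=
  finProdFinEquiv.symm.injective (Prod.ext h h')

lemma exists_proj_sheet {n : ℕ} (x : Fin n) (i : Fin 2) :
    ∃ u : Fin (n * 2), proj u = x ∧ sheet u = i :=
  ⟨finProdFinEquiv (x, i), by simp [proj], by simp [sheet]⟩

/-- Position of a vertex of the double cover in a cycle of length `2 * (4 * r + 1)`. -/
def coverPos (r : ℕ) {n : ℕ} (u : Fin (n * 2)) : ℕ :=
  basePos r (proj u) + (4 * r + 1) * (sheet u).val

/-- The half of the double cover a vertex belongs to; the halves are delimited by the two edges
over the edge between the positions `2 * r - 1` and `2 * r`. -/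
def half (r : ℕ) {n : ℕ} (u : Fin (n * 2)) : Fin 2 :=
  if (proj u).val < 2 * r then 1 - sheet u else sheet u

lemma sheet_cases {n : ℕ} (u : Fin (n * 2)) : sheet u = 0 ∨ sheet u = 1 := by
  generalize sheet u = i
  fin_cases i <;> simp

lemma coverPos_cases (r : ℕ) {n : ℕ} (u : Fin (n * 2)) :
    (sheet u = 0 ∧ coverPos r u = basePos r (proj u)) ∨
      (sheet u = 1 ∧ coverPos r u = basePos r (proj u) + (4 * r + 1)) := by
  rcases sheet_cases u with h | h <;> simp [coverPos, h]

lemma coverPos_lt (r : ℕ) {n : ℕ} (u : Fin (n * 2)) : coverPos r u < 2 * (4 * r + 1) := by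
  have := basePos_lt r (proj u)
  rcases coverPos_cases r u with h | h <;> omega

lemma coverPos_surj {r n : ℕ} (hn : 4 * r + 1 ≤ n) (p : ℕ) (hp : p < 2 * (4 * r + 1)) :
    ∃ u : Fin (n * 2), coverPos r u = p := by
  by_cases h : p < 4 * r + 1
  · obtain ⟨x, hx⟩ := basePos_surj hn p h
    obtain ⟨u, rfl, hu⟩ := exists_proj_sheet x 0
    exact ⟨u, by simp [coverPos, hx, hu]⟩
  · obtain ⟨x, hx⟩ := basePos_surj hn (p - (4 * r + 1)) (by omega)
    obtain ⟨u, rfl, hu⟩ := exists_proj_sheet x 1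
    exact ⟨u, by simp only [coverPos, hx, hu, Fin.val_one]; omega⟩

/-- The double cover of the base networks, with two selected vertices. -/
def coverNet (r n : ℕ) (hr : 1 ≤ r) (hn : 4 * r + 1 ≤ n) (a b : Fin 2 → Fin n)
    (ha : Function.Injective a) (hb : Function.Injective b) : Network where
  n := n * 2
  G := cycleBlowup (2 * (4 * r + 1)) (coverPos r)
  conn :=
    haveI : Nonempty (Fin (n * 2)) := ⟨⟨0, by omega⟩⟩
    cycleBlowup_connected (by omega) (coverPos_lt r) (coverPos_surj hn)
  sel u := decide ((proj u).val = 0)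
  ids u := blockId r (a (half r u)) (b (half r u)) (proj u)
  ids_inj u w h := by
    obtain ⟨h₁, h₂⟩ := blockId_inj h
    refine ext_proj_sheet h₁ ?_
    simp only [half, h₁] at h₂
    split_ifs at h₂ with hlt
    · simpa using hb h₂
    · exact ha h₂

section cover

variable {r n : ℕ}

lemma cover_hom {u w : Fin (n * 2)} (hr : 1 ≤ r)
    (h : (cycleBlowup (2 * (4 * r + 1)) (coverPos r)).Adj u w) :
    (cycleBlowup (4 * r + 1) (basePos r)).Adj (proj u) (proj w) := by
  have := basePos_lt r (proj u)
  have := basePos_lt r (proj w)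
  rw [cycleBlowup_adj] at h ⊢
  rcases coverPos_cases r u with hu | hu <;> rcases coverPos_cases r w with hw | hw <;> omega

lemma cover_lift {u : Fin (n * 2)} {y : Fin n}
    (h : (cycleBlowup (4 * r + 1) (basePos r)).Adj (proj u) y) :
    ∃ w, (cycleBlowup (2 * (4 * r + 1)) (coverPos r)).Adj u w ∧ proj w = y := by
  obtain ⟨w₀, rfl, h₀⟩ := exists_proj_sheet y 0
  obtain ⟨w₁, h₂, h₁⟩ := exists_proj_sheet (proj w₀) 1
  have := basePos_lt r (proj u)
  have := basePos_lt r (proj w₀)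
  have hw₀ : coverPos r w₀ = basePos r (proj w₀) := by simp [coverPos, h₀]
  have hw₁ : coverPos r w₁ = basePos r (proj w₀) + (4 * r + 1) := by simp [coverPos, h₁, h₂]
  rw [cycleBlowup_adj] at h
  by_cases hadj : (cycleBlowup (2 * (4 * r + 1)) (coverPos r)).Adj u w₀
  · exact ⟨w₀, hadj, rfl⟩
  · refine ⟨w₁, ?_, h₂⟩
    rw [cycleBlowup_adj] at hadj ⊢
    rcases coverPos_cases r u with hu | hu <;> omega

lemma cover_pos_of_mem_ball {hr : 1 ≤ r} {hn : 4 * r + 1 ≤ n} {a b : Fin 2 → Fin n}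
    {ha : Function.Injective a} {hb : Function.Injective b} {v u : Fin (n * 2)}
    (hu : u ∈ (coverNet r n hr hn a b ha hb).ball r v) :
    (coverPos r v ≤ coverPos r u + r ∧ coverPos r u ≤ coverPos r v + r) ∨
      coverPos r v + 2 * (4 * r + 1) ≤ coverPos r u + r ∨
      coverPos r u + 2 * (4 * r + 1) ≤ coverPos r v + r := by
  obtain ⟨w, hw⟩ := (coverNet r n hr hn a b ha hb).conn.exists_walk_length_eq_dist v u
  have h : (coverPos r v ≤ coverPos r u + w.length ∧ coverPos r u ≤ coverPos r v + w.length) ∨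
      coverPos r v + 2 * (4 * r + 1) ≤ coverPos r u + w.length ∨
      coverPos r u + 2 * (4 * r + 1) ≤ coverPos r v + w.length :=
    cycleBlowup_pos_of_walk (coverPos_lt r) w
  have hlen : w.length ≤ r := hw.trans_le hu
  omega

lemma cover_exists_ball_iso {hr : 1 ≤ r} {hn : 4 * r + 1 ≤ n} {a b : Fin 2 → Fin n}
    {ha : Function.Injective a} {hb : Function.Injective b} (a' b' : Fin n) (v : Fin (n * 2)) :
    ∃ φ : (coverNet r n hr hn a b ha hb).G.induce ((coverNet r n hr hn a b ha hb).ball r v) ≃g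
        (baseNet r n hr hn a' b').G.induce ((baseNet r n hr hn a' b').ball r (proj v)),
      ∀ x : (coverNet r n hr hn a b ha hb).ball r v, (φ x).1 = proj x.1 := by
  refine Network.exists_ball_iso (N := coverNet r n hr hn a b ha hb)
    (M := baseNet r n hr hn a' b') proj (fun u w h => cover_hom hr h)
    (fun u y h => cover_lift h) r v ?_ ?_
  · intro u hu w hw h
    have hu' := cover_pos_of_mem_ball hu
    have hw' := cover_pos_of_mem_ball hw
    have := basePos_lt r (proj u)
    have := coverPos_lt r v
    refine ext_proj_sheet h ?_
    have hcu := coverPos_cases r u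
    have hcw := coverPos_cases r w
    rw [← h] at hcw
    rcases hcu with hcu | hcu <;> rcases hcw with hcw | hcw <;>
      first
      | exact hcu.1.trans hcw.1.symm
      | omega
  · intro u hu w hw h
    have hu' := cover_pos_of_mem_ball hu
    have hw' := cover_pos_of_mem_ball hw
    have := basePos_lt r (proj u)
    have := basePos_lt r (proj w)
    have := coverPos_lt r v
    replace h := cycleBlowup_adj.1 h
    refine cycleBlowup_adj.2 ?_
    rcases coverPos_cases r u with hcu | hcu <;> rcases coverPos_cases r w with hcw | hcw <;> omega

lemma half_cases (u : Fin (n * 2)) :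
    (basePos r (proj u) < 2 * r ∧ half r u = 1 - sheet u) ∨
      (2 * r ≤ basePos r (proj u) ∧ half r u = sheet u) := by
  unfold half basePos
  split_ifs with h
  · exact Or.inl ⟨by omega, rfl⟩
  · exact Or.inr ⟨by omega, rfl⟩

/-- Away from the edges delimiting the halves, a ball is contained in a half. -/
lemma half_eq_of_mem_ball {hr : 1 ≤ r} {hn : 4 * r + 1 ≤ n} {a b : Fin 2 → Fin n}
    {ha : Function.Injective a} {hb : Function.Injective b} {v u : Fin (n * 2)}
    (hv : ¬ (r ≤ basePos r (proj v) ∧ basePos r (proj v) < 3 * r))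
    (hu : u ∈ (coverNet r n hr hn a b ha hb).ball r v) : half r u = half r v := by
  have hu' := cover_pos_of_mem_ball hu
  have := basePos_lt r (proj u)
  have := basePos_lt r (proj v)
  rcases coverPos_cases r u with ⟨hsu, hcu⟩ | ⟨hsu, hcu⟩ <;>
    rcases coverPos_cases r v with ⟨hsv, hcv⟩ | ⟨hsv, hcv⟩ <;>
    rcases half_cases (r := r) u with ⟨hhu, heu⟩ | ⟨hhu, heu⟩ <;>
    rcases half_cases (r := r) v with ⟨hhv, hev⟩ | ⟨hhv, hev⟩ <;>
    rw [heu, hev, hsu, hsv] <;> first | rfl | omega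

/-- Near an edge delimiting the halves, a ball is contained in a sheet and avoids the blown-up
position. -/
lemma sheet_eq_of_mem_ball {hr : 1 ≤ r} {hn : 4 * r + 1 ≤ n} {a b : Fin 2 → Fin n}
    {ha : Function.Injective a} {hb : Function.Injective b} {v u : Fin (n * 2)}
    (hv : r ≤ basePos r (proj v) ∧ basePos r (proj v) < 3 * r)
    (hu : u ∈ (coverNet r n hr hn a b ha hb).ball r v) :
    sheet u = sheet v ∧ (proj u).val < 4 * r := by
  have hu' := cover_pos_of_mem_ball hu
  have := basePos_lt r (proj u)
  have hval : basePos r (proj u) < 4 * r → (proj u).val < 4 * r := by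
    unfold basePos
    omega
  rcases coverPos_cases r u with ⟨hsu, hcu⟩ | ⟨hsu, hcu⟩ <;>
    rcases coverPos_cases r v with ⟨hsv, hcv⟩ | ⟨hsv, hcv⟩ <;>
    first
    | exact ⟨hsu.trans hsv.symm, hval (by omega)⟩
    | omega

end cover

/-- If the base networks built from two pairs of identifier blocks are accepted with certificates
that agree on the first `4 * r` vertices, then the double cover is accepted. -/
lemma cover_accepts {r n : ℕ} {hr : 1 ≤ r} {hn : 4 * r + 1 ≤ n} {A : Verifier}
    (hA : IsLocalVerifier r A) {a b : Fin 2 → Fin n} (ha : Function.Injective a)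
    (hb : Function.Injective b) (P : Fin n → Fin n → Fin n → List Bool)
    (hP : ∀ i j v, A (baseNet r n hr hn (a i) (b j)) (P (a i) (b j)) v = true)
    (hcol : ∀ i j i' j', ∀ x : Fin n, x.val < 4 * r → P (a i) (b j) x = P (a i') (b j') x)
    (v : Fin (n * 2)) :
    A (coverNet r n hr hn a b ha hb)
      (fun u : Fin (n * 2) => P (a (half r u)) (b (half r u)) (proj u)) v = true := by
  suffices h : ∃ i j, ∀ u ∈ (coverNet r n hr hn a b ha hb).ball r v,
      blockId r (a (half r u)) (b (half r u)) (proj u) = blockId r (a i) (b j) (proj u) ∧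
      P (a (half r u)) (b (half r u)) (proj u) = P (a i) (b j) (proj u) by
    obtain ⟨i, j, h⟩ := h
    obtain ⟨φ, hφ⟩ := cover_exists_ball_iso (hr := hr) (hn := hn) (ha := ha) (hb := hb)
      (a i) (b j) v
    rw [← hP i j (proj v)]
    refine hA (coverNet r n hr hn a b ha hb) (baseNet r n hr hn (a i) (b j)) _ _ v (proj v) φ
      (fun x => ?_) (fun x => ?_) (fun x => ?_) (Subtype.ext (hφ _))
    · rw [hφ]
      rfl
    · rw [hφ]
      exact (h x.1 x.2).1
    · rw [hφ]
      exact (h x.1 x.2).2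
  by_cases hv : r ≤ basePos r (proj v) ∧ basePos r (proj v) < 3 * r
  · refine ⟨sheet v, 1 - sheet v, fun u hu => ?_⟩
    obtain ⟨hs, hlt⟩ := sheet_eq_of_mem_ball hv hu
    refine ⟨?_, hcol _ _ _ _ _ hlt⟩
    unfold blockId half
    split_ifs <;> rw [hs]
  · refine ⟨half r v, half r v, fun u hu => ?_⟩
    rw [half_eq_of_mem_ball hv hu]
    exact ⟨rfl, rfl⟩

/-! ### Counting -/

/-- A coloring of the edges of a large complete bipartite graph has a monochromatic 4-cycle. -/
lemma exists_monochromatic_four_cycle_s2 {C : Type} [Fintype C] {n : ℕ}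
    (hn : (Fintype.card C + 1) * ((Fintype.card C + 1) * Fintype.card C) < n)
    (hn' : Fintype.card C + 1 ≤ n) (col : Fin n → Fin n → C) :
    ∃ a b : Fin 2 → Fin n, Function.Injective a ∧ Function.Injective b ∧
      ∀ i j i' j', col (a i) (b j) = col (a i') (b j') := by
  have h₁ : ∀ y : Fin n, ∃ p : Fin (Fintype.card C + 1) × Fin (Fintype.card C + 1), p.1 ≠ p.2 ∧
      col (Fin.castLE hn' p.1) y = col (Fin.castLE hn' p.2) y := fun y => by
    obtain ⟨x, x', hne, h⟩ := Fintype.exists_ne_map_eq_of_card_lt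
      (fun x : Fin (Fintype.card C + 1) => col (Fin.castLE hn' x) y) (by simp)
    exact ⟨(x, x'), hne, h⟩
  choose p hne hp using h₁
  obtain ⟨y, y', hyne, h⟩ := Fintype.exists_ne_map_eq_of_card_lt
    (fun y : Fin n => ((p y).1, (p y).2, col (Fin.castLE hn' (p y).1) y)) (by simpa using hn)
  simp only [Prod.mk.injEq] at h
  obtain ⟨e₁, e₂, e₃⟩ := h
  have e₄ := hp y
  have e₅ := hp y'
  refine ⟨![Fin.castLE hn' (p y).1, Fin.castLE hn' (p y).2], ![y, y'], ?_, ?_, ?_⟩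
  · have := hne y
    intro i j
    fin_cases i <;> fin_cases j <;> simp [this, this.symm]
  · intro i j
    fin_cases i <;> fin_cases j <;> simp [hyne, hyne.symm]
  · rw [← e₁, ← e₂] at e₅
    rw [← e₁] at e₃
    have key : ∀ i j, col (![Fin.castLE hn' (p y).1, Fin.castLE hn' (p y).2] i) (![y, y'] j) =
        col (Fin.castLE hn' (p y).1) y := by
      intro i j
      fin_cases i <;> fin_cases j <;> simp [← e₄, ← e₅, ← e₃]
    intro i j i' j'
    rw [key, key]

lemma list_eq_of_getElem?_eq {α : Type} {m : ℕ} {l l' : List α} (hl : l.length ≤ m)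
    (hl' : l'.length ≤ m) (h : ∀ i : Fin m, l[i.val]? = l'[i.val]?) : l = l' := by
  refine List.ext_getElem? fun i => ?_
  by_cases hi : i < m
  · exact h ⟨i, hi⟩
  · rw [List.getElem?_eq_none (by omega), List.getElem?_eq_none (by omega)]

lemma eventually_color_count_lt {r : ℕ} (hr : 1 ≤ r) {s : ℕ → ℕ}
    (hs : (fun n : ℕ => (s n : ℝ)) =o[atTop] fun n : ℕ => Real.log n) :
    ∀ᶠ n : ℕ in atTop, ((3 ^ s n) ^ (4 * r) + 1) * (((3 ^ s n) ^ (4 * r) + 1) *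
      (3 ^ s n) ^ (4 * r)) < n := by
  have hr' : (1 : ℝ) ≤ r := by exact_mod_cast hr
  have hε : (0 : ℝ) < 1 / (48 * r) := by positivity
  filter_upwards [hs.def hε, eventually_gt_atTop 16] with n hsn hn
  have hn' : (16 : ℝ) < n := by exact_mod_cast hn
  have hlog : Real.log 16 < Real.log n := Real.log_lt_log (by norm_num) hn'
  have hlog16 : Real.log 16 = 2 * Real.log 4 := by
    rw [← Real.log_rpow (by norm_num)]
    norm_num
  have hlog4 : 0 < Real.log 4 := Real.log_pos (by norm_num)
  have hlog3 : Real.log 3 < 2 := by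
    have := Real.log_lt_sub_one_of_pos (x := 3) (by norm_num) (by norm_num)
    linarith
  rw [Real.norm_of_nonneg (by positivity), Real.norm_of_nonneg (by linarith)] at hsn
  have hsn' : 48 * r * (s n : ℝ) ≤ Real.log n := by
    rw [div_mul_eq_mul_div, one_mul, le_div_iff₀ (by positivity)] at hsn
    linarith
  have hlt : (4 : ℝ) * ((3 ^ s n) ^ (4 * r)) ^ 3 < n := by
    rw [← Real.log_lt_log_iff (by positivity) (by linarith),
      Real.log_mul (by norm_num) (by positivity), Real.log_pow, Real.log_pow, Real.log_pow]
    push_cast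
    have h0 : (0 : ℝ) ≤ r * s n := by positivity
    nlinarith
  have hlt' : 4 * ((3 ^ s n) ^ (4 * r)) ^ 3 < n := by exact_mod_cast hlt
  have hc : 1 ≤ (3 ^ s n) ^ (4 * r) := Nat.one_le_pow _ _ (by positivity)
  generalize (3 ^ s n) ^ (4 * r) = c at hc hlt'
  refine lt_of_le_of_lt ?_ hlt'
  calc (c + 1) * ((c + 1) * c) ≤ (2 * c) * ((2 * c) * c) := by gcongr <;> omega
    _ = 4 * c ^ 3 := by ring

/-- Certifying AMOS in graphs with bounded neighborhood diversity requires
certificates of size `Ω(log n)`: for every `r ≥ 1` there are constants `d`, `t`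
such that no `r`-local proof-labeling scheme of size `o(log n)` certifies AMOS
on connected graphs of diameter at most `d` and neighborhood diversity at most
`t` whose `n` vertices carry distinct identifiers from `{1, …, n²}`. -/
theorem amos_lower_bound_bounded_neighborhood_diversity (r : ℕ) (hr : 1 ≤ r) :
    ∃ d t : ℕ, ∀ s : ℕ → ℕ,
      ((fun n : ℕ => (s n : ℝ)) =o[atTop] fun n : ℕ => Real.log n) →
      IsEmpty (PLS r s
        (fun N => (∀ u v : Fin N.n, N.G.dist u v ≤ d) ∧
          NeighborhoodDiversityLE N.G t ∧
          (∀ v : Fin N.n, 1 ≤ N.ids v ∧ N.ids v ≤ N.n ^ 2))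
        Network.AMOS) := by
  refine ⟨2 * (4 * r + 1), 2 * (4 * r + 1), fun s hs => ⟨fun S => ?_⟩⟩
  obtain ⟨n, hcount, hn⟩ :=
    ((eventually_color_count_lt hr hs).and (eventually_ge_atTop (4 * r + 1))).exists
  have hnet : ∀ a b : Fin n, (∀ u v, (baseNet r n hr hn a b).G.dist u v ≤ 2 * (4 * r + 1)) ∧
      NeighborhoodDiversityLE (baseNet r n hr hn a b).G (2 * (4 * r + 1)) ∧
      ∀ v, 1 ≤ (baseNet r n hr hn a b).ids v ∧ (baseNet r n hr hn a b).ids v ≤ n ^ 2 :=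
    fun a b => ⟨fun u v => (cycleBlowup_dist_le (by omega) (basePos_lt r)
        (basePos_surj hn) u v).trans (by omega),
      cycleBlowup_neighborhoodDiversityLE fun x => (basePos_lt r x).trans_le (by omega),
      fun v => ⟨one_le_blockId a b v, blockId_le a b v⟩⟩
  have hamos : ∀ a b : Fin n, (baseNet r n hr hn a b).AMOS := fun a b u v hu hv =>
    Fin.ext ((of_decide_eq_true hu).trans (of_decide_eq_true hv).symm)
  let P : Fin n → Fin n → Fin n → List Bool := fun a b => S.prover (baseNet r n hr hn a b)
  have hsize : ∀ a b x, (P a b x).length ≤ s n := fun a b =>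
    S.prover_size (baseNet r n hr hn a b) (hnet a b) (hamos a b)
  let col : Fin n → Fin n → Fin (4 * r) → Fin (s n) → Option Bool :=
    fun a b x i => (P a b (Fin.castLE (by omega) x))[i.val]?
  have hcard : Fintype.card (Fin (4 * r) → Fin (s n) → Option Bool) = (3 ^ s n) ^ (4 * r) := by
    simp
  have hpos : 1 ≤ (3 ^ s n) ^ (4 * r) := Nat.one_le_pow _ _ (by positivity)
  obtain ⟨a, b, ha, hb, hab⟩ := exists_monochromatic_four_cycle_s2 (by rwa [hcard])
    (by rw [hcard]; exact (Nat.le_mul_of_pos_right _ (by positivity)).trans hcount.le) col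
  have hcol : ∀ i j i' j', ∀ x : Fin n, x.val < 4 * r →
      P (a i) (b j) x = P (a i') (b j') x := fun i j i' j' x hx =>
    list_eq_of_getElem?_eq (hsize _ _ _) (hsize _ _ _) fun k =>
      congrFun (congrFun (hab i j i' j') ⟨x.val, hx⟩) k
  obtain ⟨v, hv⟩ := S.soundness (coverNet r n hr hn a b ha hb)
    ⟨cycleBlowup_dist_le (by omega) (coverPos_lt r) (coverPos_surj hn),
      cycleBlowup_neighborhoodDiversityLE (coverPos_lt r),
      fun v => ⟨one_le_blockId _ _ _, (blockId_le _ _ _).trans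
        (Nat.pow_le_pow_left (Nat.le_mul_of_pos_right n two_pos) 2)⟩⟩
    (fun h => by
      obtain ⟨u₀, hu₀, hs₀⟩ := exists_proj_sheet (⟨0, by omega⟩ : Fin n) 0
      obtain ⟨u₁, hu₁, hs₁⟩ := exists_proj_sheet (⟨0, by omega⟩ : Fin n) 1
      have heq : u₀ = u₁ := h u₀ u₁ (by simp [coverNet, hu₀]) (by simp [coverNet, hu₁])
      rw [heq, hs₁] at hs₀
      exact absurd hs₀ (by decide))
    (fun u : Fin (n * 2) => P (a (half r u)) (b (half r u)) (proj u))
  have hacc := cover_accepts (hr := hr) (hn := hn) S.verifier_local ha hb P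
    (fun i j => S.completeness (baseNet r n hr hn (a i) (b j)) (hnet _ _) (hamos _ _)) hcol v
  exact Bool.false_ne_true (hv.symm.trans hacc)
end

section
/- There is a constant C such that for every integer D ≥ 1 there exists a 2-local proof-labeling scheme (f, A) of size at most C·log D in the anonymous setting which, on labeled connected chordal graphs of diameter at most D, accepts a graph G if and only if G has at most one selected vertex (i.e., if and only if G satisfies AMOS). -/
open SimpleGraph Filter

/-- An anonymous network configuration: a finite connected simple graph whose
vertices carry an input bit (`sel`, "selected") but no identifiers. -/
structure ANetwork where
  n : ℕ
  G : SimpleGraph (Fin n)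
  conn : G.Connected
  sel : Fin n → Bool

/-- AMOS: at most one vertex is selected. -/
def ANetwork.AMOS (N : ANetwork) : Prop :=
  ∀ u v : Fin N.n, N.sel u = true → N.sel v = true → u = v

/-- The radius-`r` ball around `v`. -/
def ANetwork.ball (N : ANetwork) (r : ℕ) (v : Fin N.n) : Set (Fin N.n) :=
  {u : Fin N.n | N.G.dist v u ≤ r}

lemma ANetwork.center_mem_ball (N : ANetwork) (r : ℕ) (v : Fin N.n) :
    v ∈ N.ball r v := by
  simp [ANetwork.ball, SimpleGraph.dist_self]

/-- A verifier: at each vertex of each network, given certificates (bit strings),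
it accepts (`true`) or rejects (`false`). -/
def AVerifier : Type :=
  ∀ N : ANetwork, (Fin N.n → List Bool) → Fin N.n → Bool

/-- `r`-locality in the anonymous setting: the decision at `v` only depends on
the radius-`r` ball around `v` (the subgraph induced by the vertices at distance
at most `r` from `v`, together with the input bits and the certificates in the
ball), and is invariant under isomorphisms of the ball preserving input bits and
certificates. -/
def IsLocalAVerifier (r : ℕ) (A : AVerifier) : Prop :=
  ∀ (N N' : ANetwork) (P : Fin N.n → List Bool) (P' : Fin N'.n → List Bool)
    (v : Fin N.n) (v' : Fin N'.n)
    (φ : (N.G.induce (N.ball r v)) ≃g (N'.G.induce (N'.ball r v'))),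
    (∀ x : N.ball r v, N.sel x.1 = N'.sel (φ x).1) →
    (∀ x : N.ball r v, P x.1 = P' (φ x).1) →
    φ ⟨v, N.center_mem_ball r v⟩ = ⟨v', N'.center_mem_ball r v'⟩ →
    A N P v = A N' P' v'

/-- An `r`-local proof-labeling scheme of size `size` for the property `Pr`
on the class of anonymous networks `Net`: a prover assigning certificates of at
most `size` bits on yes-instances (completeness), such that on no-instances
every certificate assignment is rejected at some vertex (soundness). -/
structure APLS (r : ℕ) (size : ℕ) (Net : ANetwork → Prop) (Pr : ANetwork → Prop) where
  prover : ∀ N : ANetwork, Fin N.n → List Bool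
  verifier : AVerifier
  verifier_local : IsLocalAVerifier r verifier
  prover_size : ∀ N : ANetwork, Net N → Pr N → ∀ v, (prover N v).length ≤ size
  completeness : ∀ N : ANetwork, Net N → Pr N → ∀ v, verifier N (prover N) v = true
  soundness : ∀ N : ANetwork, Net N → ¬ Pr N →
    ∀ P : Fin N.n → List Bool, ∃ v, verifier N P v = false

/-- A graph is chordal if it has no induced cycle of length at least 4. -/
def Chordal {V : Type} (G : SimpleGraph V) : Prop :=
  ∀ (s : Set V) (m : ℕ), 4 ≤ m → IsEmpty ((G.induce s) ≃g cycleGraph m)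

namespace SimpleGraph

variable {V : Type} {G : SimpleGraph V}

lemma Connected.exists_adj_dist_add_one_eq (hG : G.Connected) {r x : V} (hx : G.dist r x ≠ 0) :
    ∃ y, G.Adj x y ∧ G.dist r y + 1 = G.dist r x := by
  obtain ⟨p, hp⟩ := hG.exists_walk_length_eq_dist x r
  rw [dist_comm] at hp
  cases p with
  | nil => simp at hx
  | @cons _ y _ h q =>
    refine ⟨y, h, ?_⟩
    have h1 := dist_le q
    rw [dist_comm] at h1
    have h2 := hG.dist_triangle (u := r) (v := y) (w := x)
    rw [dist_eq_one_iff_adj.2 h.symm] at h2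
    simp only [Walk.length_cons] at hp
    lia

lemma Connected.reachable_of_dist_le (hG : G.Connected) {H : SimpleGraph V} {r : V} {k : ℕ}
    (hH : ∀ x y, G.Adj x y → G.dist r x ≤ k → G.dist r y ≤ k → H.Adj x y)
    {x : V} (hx : G.dist r x ≤ k) : H.Reachable r x := by
  induction hn : G.dist r x generalizing x with
  | zero => rw [(hG.dist_eq_zero_iff).1 hn]
  | succ n ih =>
    obtain ⟨y, hxy, hy⟩ := hG.exists_adj_dist_add_one_eq (r := r) (x := x) (by lia)
    exact (ih (by lia) (by lia)).trans (hH y x hxy.symm (by lia) hx).reachable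

/-- The edges of `G` inside `S`, apart from the edge `uv`. -/
def restrictAvoiding (G : SimpleGraph V) (S : Set V) (u v : V) : SimpleGraph V where
  Adj x y := G.Adj x y ∧ x ∈ S ∧ y ∈ S ∧ s(x, y) ≠ s(u, v)
  symm := ⟨fun x y h => ⟨h.1.symm, h.2.2.1, h.2.1, by rw [Sym2.eq_swap]; exact h.2.2.2⟩⟩
  loopless := ⟨fun x h => h.1.ne rfl⟩

/-- In a chordal graph, an edge lying on a cycle in `S` lies in a triangle in `S`. -/
lemma _root_.Chordal.exists_common_neighbor (hG : Chordal G) {S : Set V} {u v : V}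
    (huv : G.Adj u v) (hr : (G.restrictAvoiding S u v).Reachable u v) :
    ∃ w ∈ S, G.Adj u w ∧ G.Adj v w := by
  set H := G.restrictAvoiding S u v
  obtain ⟨p, hp⟩ := hr.exists_walk_length_eq_dist
  have hpath := p.isPath_of_length_eq_dist hp
  have hinj := hpath.getVert_injOn
  have hdist : ∀ i ≤ p.length, H.dist u (p.getVert i) = i := by
    intro i hi
    have := length_eq_dist_of_subwalk hp (p.isSubwalk_take i)
    rw [← this, Walk.take_length]
    lia
  have hchord : ∀ i j, i < j → j ≤ p.length →
      (G.Adj (p.getVert i) (p.getVert j) ↔ j = i + 1 ∨ (i = 0 ∧ j = p.length)) := by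
    intro i j hij hj
    constructor
    · intro h
      by_cases hs : s(p.getVert i, p.getVert j) = s(u, v)
      · right
        rw [Sym2.eq_iff] at hs
        have e0 : ∀ k ≤ p.length, p.getVert k = u → k = 0 := fun k hk h =>
          hinj (by simpa using hk) (by simp) (by simpa using h)
        have e1 : ∀ k ≤ p.length, p.getVert k = v → k = p.length := fun k hk h =>
          hinj (by simpa using hk) (by simp) (by simpa using h)
        rcases hs with ⟨h1, h2⟩ | ⟨h1, h2⟩
        · exact ⟨e0 i (by lia) h1, e1 j hj h2⟩
        · have := e1 i (by lia) h1
          lia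
      · left
        have hmem : ∀ k ≤ p.length, p.getVert k ∈ S := by
          intro k hk
          rcases Nat.lt_or_ge k p.length with hk' | hk'
          · exact (p.adj_getVert_succ hk').2.1
          · have h0 : 0 < p.length := by lia
            have := (p.adj_getVert_succ (i := k - 1) (by lia)).2.2.1
            rwa [Nat.sub_add_cancel (by lia)] at this
        have hadj : H.Adj (p.getVert i) (p.getVert j) := ⟨h, hmem i (by lia), hmem j hj, hs⟩
        have := hadj.reachable.dist_triangle_right u
        rw [hdist i (by lia), hdist j hj, dist_eq_one_iff_adj.2 hadj] at this
        lia
    · rintro (rfl | ⟨rfl, rfl⟩)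
      · exact (p.adj_getVert_succ (by lia)).1
      · simpa using huv
  rcases Nat.lt_or_ge p.length 3 with hlt | hge
  · have h0 : p.length ≠ 0 := fun h => huv.ne (Walk.eq_of_length_eq_zero h)
    have h1 : p.length ≠ 1 := fun h => (Walk.adj_of_length_eq_one h).2.2.2 rfl
    have h2 : p.length = 2 := by lia
    have a := p.adj_getVert_succ (i := 0) (by lia)
    have b := p.adj_getVert_succ (i := 1) (by lia)
    have e : p.getVert (1 + 1) = v := by rw [show 1 + 1 = p.length by lia]; simp
    rw [e] at b
    rw [Walk.getVert_zero] at a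
    exact ⟨p.getVert 1, b.2.1, a.1, b.1.symm⟩
  · exfalso
    let g : Fin (p.length + 1) → V := fun i => p.getVert i
    have ginj : Function.Injective g := fun i j h =>
      Fin.ext (hinj (by simp; lia) (by simp; lia) h)
    refine (hG (Set.range g) (p.length + 1) (by lia)).false
      (Iso.symm ⟨Equiv.ofInjective g ginj, ?_⟩)
    intro i j
    simp only [Equiv.ofInjective_apply, comap_adj, Function.Embedding.subtype_apply,
      cycleGraph_adj', g]
    have hi := i.isLt
    have hj := j.isLt
    rcases lt_trichotomy i j with h | h | h
    · rw [hchord i j h (by lia), Fin.coe_sub_iff_lt.2 h, Fin.coe_sub_iff_le.2 h.le]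
      have : i.val < j.val := h
      lia
    · subst h
      simp
    · rw [adj_comm, hchord j i h (by lia), Fin.coe_sub_iff_lt.2 h, Fin.coe_sub_iff_le.2 h.le]
      have : j.val < i.val := h
      lia

lemma _root_.Chordal.adj_of_dist_add_one_eq (hG : Chordal G) (hc : G.Connected) {r v a b : V}
    (hva : G.Adj v a) (hvb : G.Adj v b) (ha : G.dist r a + 1 = G.dist r v)
    (hb : G.dist r b + 1 = G.dist r v) (hab : a ≠ b) : G.Adj a b := by
  have ha0 : G.dist r a ≠ 0 := fun h => hab <| by
    rw [← hc.dist_eq_zero_iff.1 h, ← hc.dist_eq_zero_iff.1 (show G.dist r b = 0 by lia)]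
  obtain ⟨a', haa, hda⟩ := hc.exists_adj_dist_add_one_eq ha0
  obtain ⟨b', hbb, hdb⟩ := hc.exists_adj_dist_add_one_eq (r := r) (x := b) (by lia)
  let S : Set V := {x | x = v ∨ x = a ∨ x = b ∨ G.dist r x < G.dist r a}
  let H := G.restrictAvoiding S v a
  have hlow : ∀ x y, G.Adj x y → G.dist r x ≤ G.dist r a - 1 →
      G.dist r y ≤ G.dist r a - 1 → H.Adj x y := by
    refine fun x y h hx hy => ⟨h, by grind, by grind, fun h => ?_⟩
    rcases Sym2.eq_iff.1 h with ⟨rfl, rfl⟩ | ⟨rfl, rfl⟩ <;> lia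
  have h1 : H.Adj v b := ⟨hvb, by grind, by grind, by simp [hab.symm, hva.ne]⟩
  have h2 : H.Adj b b' := by
    refine ⟨hbb, by grind, by grind, fun h => ?_⟩
    rcases Sym2.eq_iff.1 h with ⟨rfl, rfl⟩ | ⟨rfl, rfl⟩ <;> lia
  have h3 : H.Adj a a' := by
    refine ⟨haa, by grind, by grind, fun h => ?_⟩
    rcases Sym2.eq_iff.1 h with ⟨h, -⟩ | ⟨-, h⟩
    · exact hva.ne h.symm
    · rw [h] at hda
      lia
  have h4 := hc.reachable_of_dist_le hlow (x := a') (by lia)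
  have h5 := hc.reachable_of_dist_le hlow (x := b') (by lia)
  obtain ⟨w, hw, hvw, haw⟩ := hG.exists_common_neighbor hva
    (((h1.reachable.trans h2.reachable).trans h5.symm).trans (h4.trans h3.symm.reachable))
  rcases hw with rfl | rfl | rfl | hw
  · exact absurd rfl hvw.ne
  · exact absurd rfl haw.ne
  · exact haw
  · have := hc.dist_triangle (u := r) (v := w) (w := v)
    rw [dist_eq_one_iff_adj.2 hvw.symm] at this
    lia

lemma _root_.Chordal.exists_common_lower_neighbor (hG : Chordal G) (hc : G.Connected) {r u v : V}
    (huv : G.Adj u v) (h : G.dist r u = G.dist r v) :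
    ∃ w, G.Adj u w ∧ G.Adj v w ∧ G.dist r w + 1 = G.dist r u := by
  have h0 : G.dist r u ≠ 0 := fun h0 => huv.ne <| by
    rw [← hc.dist_eq_zero_iff.1 h0, ← hc.dist_eq_zero_iff.1 (h.symm.trans h0)]
  obtain ⟨a, hua, hda⟩ := hc.exists_adj_dist_add_one_eq h0
  obtain ⟨b, hvb, hdb⟩ := hc.exists_adj_dist_add_one_eq (r := r) (x := v) (by lia)
  let S : Set V := {x | x = u ∨ x = v ∨ G.dist r x < G.dist r u}
  let H := G.restrictAvoiding S u v
  have hH : ∀ x y, G.Adj x y → x ∈ S → y ∈ S → G.dist r y < G.dist r u → H.Adj x y := by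
    refine fun x y h hx hy hlt => ⟨h, hx, hy, fun h => ?_⟩
    rcases Sym2.eq_iff.1 h with ⟨rfl, rfl⟩ | ⟨rfl, rfl⟩ <;> lia
  have hlow : ∀ x y, G.Adj x y → G.dist r x ≤ G.dist r u - 1 →
      G.dist r y ≤ G.dist r u - 1 → H.Adj x y :=
    fun x y h hx hy => hH x y h (by grind) (by grind) (by lia)
  have h1 : H.Adj u a := hH u a hua (by grind) (by grind) (by lia)
  have h2 : H.Adj v b := hH v b hvb (by grind) (by grind) (by lia)
  have h4 := hc.reachable_of_dist_le hlow (x := a) (by lia)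
  have h5 := hc.reachable_of_dist_le hlow (x := b) (by lia)
  obtain ⟨w, hw, huw, hvw⟩ := hG.exists_common_neighbor huv
    ((h1.reachable.trans h4.symm).trans (h5.trans h2.symm.reachable))
  rcases hw with rfl | rfl | hw
  · exact absurd rfl huw.ne
  · exact absurd rfl hvw.ne
  · refine ⟨w, huw, hvw, ?_⟩
    have := hc.dist_triangle (u := r) (v := w) (w := u)
    rw [dist_eq_one_iff_adj.2 huw.symm] at this
    lia

/-- The local conditions at `c` saying that `lvl` looks like the distance to a single vertex of a
chordal graph, which is the only one that may be selected. -/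
structure IsLevelingAt (G : SimpleGraph V) (sel : V → Bool) (lvl : V → ℕ) (c : V) : Prop where
  sel_imp : sel c = true → lvl c = 0
  le_add_one : ∀ x, G.Adj c x → lvl x ≤ lvl c + 1
  ne_zero : ∀ x, G.Adj c x → lvl c = 0 → lvl x ≠ 0
  clique : ∀ x y, G.Adj c x → G.Adj c y → lvl x + 1 = lvl c → lvl y + 1 = lvl c → x ≠ y →
    G.Adj x y
  common : ∀ x, G.Adj c x → lvl x = lvl c →
    ∃ w, G.Adj c w ∧ G.Adj x w ∧ lvl w + 1 = lvl c

lemma _root_.Chordal.isLevelingAt_dist (hG : Chordal G) (hc : G.Connected) {sel : V → Bool} {r : V}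
    (hr : ∀ x, sel x = true → x = r) (c : V) : G.IsLevelingAt sel (G.dist r) c where
  sel_imp h := by simp [hr c h]
  le_add_one x h := by
    have := hc.dist_triangle (u := r) (v := c) (w := x)
    rwa [dist_eq_one_iff_adj.2 h] at this
  ne_zero x h hc0 hx0 := h.ne <| by rw [← hc.dist_eq_zero_iff.1 hc0, ← hc.dist_eq_zero_iff.1 hx0]
  clique x y hx hy hlx hly hxy := hG.adj_of_dist_add_one_eq hc hx hy hlx hly hxy
  common x hx h := hG.exists_common_lower_neighbor hc hx h.symm

lemma IsLevelingAt.of_iso {W : Type} {G' : SimpleGraph W} {sel : V → Bool} {sel' : W → Bool}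
    {lvl : V → ℕ} {lvl' : W → ℕ} {c : V} (h : G.IsLevelingAt sel lvl c) (φ : G ≃g G')
    (hsel : ∀ x, sel x = sel' (φ x)) (hlvl : ∀ x, lvl x = lvl' (φ x)) :
    G'.IsLevelingAt sel' lvl' (φ c) where
  sel_imp := by simpa [hsel, hlvl] using h.sel_imp
  le_add_one := by
    rw [φ.surjective.forall]
    simpa [hlvl, φ.map_adj_iff] using h.le_add_one
  ne_zero := by
    rw [φ.surjective.forall]
    simpa [hlvl, φ.map_adj_iff] using h.ne_zero
  clique := by
    simp only [φ.surjective.forall]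
    simpa [hlvl, φ.map_adj_iff] using h.clique
  common := by
    simp only [φ.surjective.forall, φ.surjective.exists]
    simpa [hlvl, φ.map_adj_iff] using h.common

lemma isLevelingAt_induce_iff {sel : V → Bool} {lvl : V → ℕ} {s : Set V} {c : V} (hc : c ∈ s)
    (hs : ∀ x, G.Adj c x → x ∈ s) :
    (G.induce s).IsLevelingAt (fun x => sel x) (fun x => lvl x) ⟨c, hc⟩ ↔
      G.IsLevelingAt sel lvl c := by
  constructor
  · intro h
    refine ⟨h.sel_imp, fun x hx => h.le_add_one ⟨x, hs x hx⟩ hx,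
      fun x hx => h.ne_zero ⟨x, hs x hx⟩ hx,
      fun x y hx hy hlx hly hxy => h.clique ⟨x, hs x hx⟩ ⟨y, hs y hy⟩ hx hy hlx hly
        (by simpa using hxy), fun x hx hlx => ?_⟩
    obtain ⟨w, h1, h2, h3⟩ := h.common ⟨x, hs x hx⟩ hx hlx
    exact ⟨w, h1, h2, h3⟩
  · intro h
    refine ⟨h.sel_imp, fun x hx => h.le_add_one x hx, fun x hx => h.ne_zero x hx,
      fun x y hx hy hlx hly hxy => h.clique x y hx hy hlx hly (fun h => hxy (Subtype.ext h)),
      fun x hx hlx => ?_⟩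
    obtain ⟨w, h1, h2, h3⟩ := h.common x hx hlx
    exact ⟨⟨w, hs w h1⟩, h1, h2, h3⟩

/-- Adjacency restricted to the vertices of level at most `k`. -/
def LowAdj (G : SimpleGraph V) (lvl : V → ℕ) (k : ℕ) (x y : V) : Prop :=
  G.Adj x y ∧ lvl x ≤ k ∧ lvl y ≤ k

lemma reflTransGen_lowAdj_of_succ {sel : V → Bool} {lvl : V → ℕ}
    (h : ∀ c, G.IsLevelingAt sel lvl c) {k : ℕ} {s t : V} (hs : lvl s ≤ k)
    (hst : Relation.ReflTransGen (G.LowAdj lvl (k + 1)) s t) :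
    (lvl t ≤ k → Relation.ReflTransGen (G.LowAdj lvl k) s t) ∧
      (lvl t = k + 1 → ∀ w, G.Adj t w → lvl w = k →
        Relation.ReflTransGen (G.LowAdj lvl k) s w) := by
  have move : ∀ y a b, lvl y = k + 1 → G.Adj y a → G.Adj y b → lvl a = k → lvl b = k →
      Relation.ReflTransGen (G.LowAdj lvl k) s a → Relation.ReflTransGen (G.LowAdj lvl k) s b := by
    intro y a b hy ha hb hla hlb hsa
    by_cases hab : a = b
    · exact hab ▸ hsa
    · exact hsa.tail ⟨(h y).clique a b ha hb (by lia) (by lia) hab, by lia, by lia⟩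
  induction hst with
  | refl => exact ⟨fun _ => .refl, fun h => by lia⟩
  | @tail x y _ hxy ih =>
    obtain ⟨hadj, hx, hy⟩ := hxy
    have hle := (h x).le_add_one y hadj
    have hle' := (h y).le_add_one x hadj.symm
    rcases Nat.lt_or_ge k (lvl x) with hkx | hkx
    · have ihx := ih.2 (by lia)
      refine ⟨fun hyk => ihx y hadj (by lia), fun hyk w hw hwk => ?_⟩
      obtain ⟨c, hxc, hyc, hc⟩ := (h x).common y hadj (by lia)
      exact move y c w hyk hyc hw (by lia) hwk (ihx c hxc (by lia))
    · have ihx := ih.1 hkx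
      exact ⟨fun hyk => ihx.tail ⟨hadj, hkx, hyk⟩,
        fun hyk w hw hwk => move y x w hyk hadj.symm hw (by lia) hwk ihx⟩

/-- A leveling of a connected graph has only one vertex of level zero. -/
lemma eq_of_isLevelingAt (hc : G.Connected) [Finite V] {sel : V → Bool} {lvl : V → ℕ}
    (h : ∀ c, G.IsLevelingAt sel lvl c) {s t : V} (hs : lvl s = 0) (ht : lvl t = 0) : s = t := by
  have key : ∀ k, Relation.ReflTransGen (G.LowAdj lvl k) s t → s = t := by
    intro k
    induction k with
    | zero =>
      intro hst
      rcases hst.cases_head with rfl | ⟨x, hx, -⟩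
      · rfl
      · exact absurd (Nat.le_zero.1 hx.2.2) ((h s).ne_zero x hx.1 hs)
    | succ k ih => exact fun hst => ih ((reflTransGen_lowAdj_of_succ h (by lia) hst).1 (by lia))
  obtain ⟨k, hk⟩ := (Set.finite_range lvl).bddAbove
  have hk' : ∀ x, lvl x ≤ k := fun x => hk ⟨x, rfl⟩
  refine key k (Relation.ReflTransGen.mono (fun x y hxy => ⟨hxy, hk' x, hk' y⟩) _ _
    ((reachable_iff_reflTransGen s t).1 (hc s t)))

end SimpleGraph

lemma Nat.foldr_bit_bits (n : ℕ) : n.bits.foldr Nat.bit 0 = n := by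
  induction n using Nat.binaryRec' with
  | zero => simp
  | bit b n h ih => rw [Nat.bits_append_bit n b h, List.foldr_cons, ih]

/-- The local predicate `Q`, evaluated on the ball of radius `r`, as a verifier. -/
noncomputable def AVerifier.ofBall (r : ℕ)
    (Q : ∀ V : Type, SimpleGraph V → (V → Bool) → (V → List Bool) → V → Prop) : AVerifier :=
  open Classical in fun N P v => decide (Q _ (N.G.induce (N.ball r v)) (fun x => N.sel x)
    (fun x => P x) ⟨v, N.center_mem_ball r v⟩)

lemma AVerifier.isLocal_ofBall {r : ℕ}
    {Q : ∀ V : Type, SimpleGraph V → (V → Bool) → (V → List Bool) → V → Prop}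
    (hQ : ∀ (V W : Type) (G : SimpleGraph V) (G' : SimpleGraph W) (sel : V → Bool)
      (sel' : W → Bool) (P : V → List Bool) (P' : W → List Bool) (c : V) (φ : G ≃g G'),
      (∀ x, sel x = sel' (φ x)) → (∀ x, P x = P' (φ x)) →
      Q V G sel P c → Q W G' sel' P' (φ c)) :
    IsLocalAVerifier r (AVerifier.ofBall r Q) := by
  intro N N' P P' v v' φ hsel hP hv
  simp only [AVerifier.ofBall, decide_eq_decide]
  constructor
  · intro h
    rw [← hv]
    exact hQ _ _ _ _ _ _ _ _ _ φ hsel hP h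
  · intro h
    rw [← φ.symm_apply_apply ⟨v, _⟩, hv]
    refine hQ _ _ _ _ _ _ _ _ _ φ.symm (fun x => ?_) (fun x => ?_) h
    · simpa using (hsel (φ.symm x)).symm
    · simpa using (hP (φ.symm x)).symm

lemma ANetwork.AMOS.exists_forall_sel_eq {N : ANetwork} (h : N.AMOS) :
    ∃ r, ∀ x, N.sel x = true → x = r := by
  by_cases hs : ∃ r, N.sel r = true
  · obtain ⟨r, hr⟩ := hs
    exact ⟨r, fun x hx => h x r hx hr⟩
  · exact ⟨N.conn.nonempty.some, fun x hx => absurd ⟨x, hx⟩ hs⟩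

lemma ANetwork.mem_ball_of_adj (N : ANetwork) {v x : Fin N.n} (h : N.G.Adj v x) {r : ℕ}
    (hr : 1 ≤ r) : x ∈ N.ball r v := by
  simpa [ANetwork.ball, dist_eq_one_iff_adj.2 h] using hr

/-- On networks of diameter at most `r`, no certificate is needed. -/
lemma APLS.nonempty_of_dist_le {r : ℕ} {Net : ANetwork → Prop}
    (hNet : ∀ N, Net N → ∀ u v, N.G.dist u v ≤ r) : Nonempty (APLS r 0 Net ANetwork.AMOS) := by
  refine ⟨{
    prover := fun _ _ => []
    verifier := AVerifier.ofBall r fun _ _ sel _ _ =>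
      ∀ x y, sel x = true → sel y = true → x = y
    verifier_local := AVerifier.isLocal_ofBall ?_
    prover_size := by simp
    completeness := ?_
    soundness := ?_ }⟩
  · intro V W G G' sel sel' P P' c φ hsel _ h
    simp only [φ.surjective.forall]
    simpa [hsel] using h
  · intro N _ hA v
    simpa [AVerifier.ofBall] using fun x _ y _ hx hy => hA x y hx hy
  · intro N hN hA P
    have v := N.conn.nonempty.some
    refine ⟨v, ?_⟩
    contrapose! hA
    intro x y hx hy
    simp only [AVerifier.ofBall, ne_eq, decide_eq_false_iff_not, not_not] at hA
    exact congrArg Subtype.val (hA ⟨x, hNet N hN v x⟩ ⟨y, hNet N hN v y⟩ hx hy)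

/-- AMOS is certified on chordal graphs by the distances to the selected vertex. -/
lemma APLS.nonempty_of_chordal (D : ℕ) :
    Nonempty (APLS 2 (Nat.size D)
      (fun N => Chordal N.G ∧ (∀ u v : Fin N.n, N.G.dist u v ≤ D)) ANetwork.AMOS) := by
  classical
  let lvl : List Bool → ℕ := List.foldr Nat.bit 0
  have hver : ∀ (N : ANetwork) (P : Fin N.n → List Bool) (v : Fin N.n),
      AVerifier.ofBall 2 (fun _ G sel P c => G.IsLevelingAt sel (fun x => lvl (P x)) c) N P v = true
        ↔ N.G.IsLevelingAt N.sel (fun x => lvl (P x)) v := by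
    intro N P v
    rw [AVerifier.ofBall, decide_eq_true_iff]
    exact isLevelingAt_induce_iff (lvl := fun x => lvl (P x)) _
      fun x hx => N.mem_ball_of_adj hx one_le_two
  refine ⟨{
    prover := fun N v => if h : N.AMOS then
      (N.G.dist h.exists_forall_sel_eq.choose v).bits else []
    verifier := AVerifier.ofBall 2 fun _ G sel P c => G.IsLevelingAt sel (fun x => lvl (P x)) c
    verifier_local := AVerifier.isLocal_ofBall ?_
    prover_size := ?_
    completeness := ?_
    soundness := ?_ }⟩
  · intro V W G G' sel sel' P P' c φ hsel hP h
    exact h.of_iso φ hsel fun x => by rw [hP]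
  · intro N hN hA v
    rw [dif_pos hA, Nat.size_eq_bits_len]
    exact Nat.size_le_size (hN.2 _ _)
  · intro N hN hA v
    rw [hver]
    simp only [dif_pos hA, lvl, Nat.foldr_bit_bits]
    exact hN.1.isLevelingAt_dist N.conn hA.exists_forall_sel_eq.choose_spec v
  · intro N hN hA P
    contrapose! hA
    have h : ∀ v, N.G.IsLevelingAt N.sel (fun x => lvl (P x)) v := fun v =>
      (hver N P v).1 (by simpa using hA v)
    exact fun x y hx hy => eq_of_isLevelingAt N.conn h ((h x).sel_imp hx) ((h y).sel_imp hy)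

lemma APLS.nonempty_mono {r s s' : ℕ} {Net Pr : ANetwork → Prop} (h : s ≤ s')
    (hs : Nonempty (APLS r s Net Pr)) : Nonempty (APLS r s' Net Pr) :=
  hs.map fun S => { S with prover_size := fun N hN hP v => (S.prover_size N hN hP v).trans h }

/-- In anonymous chordal graphs, AMOS (at most one selected vertex) can be
certified with `O(log D)` bits: there is a constant `C` such that for every
`D ≥ 1` there is a 2-local proof-labeling scheme of size `C · log D` certifying
AMOS on connected chordal graphs of diameter at most `D`. -/
theorem amos_chordal_log_diameter :
    ∃ C : ℕ, ∀ D : ℕ, 1 ≤ D →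
      Nonempty (APLS 2 (C * Nat.log 2 D)
        (fun N => Chordal N.G ∧ (∀ u v : Fin N.n, N.G.dist u v ≤ D))
        ANetwork.AMOS) := by
  refine ⟨2, fun D hD => ?_⟩
  rcases Nat.lt_or_ge 1 D with hD2 | hD1
  · refine APLS.nonempty_mono ?_ (APLS.nonempty_of_chordal D)
    have h1 : 1 ≤ Nat.log 2 D := Nat.log_pos one_lt_two hD2
    have h2 : Nat.size D ≤ Nat.log 2 D + 1 := Nat.size_le.2 (Nat.lt_pow_succ_log_self one_lt_two D)
    lia
  · exact APLS.nonempty_mono (Nat.zero_le _)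
      (APLS.nonempty_of_dist_le fun N hN u v => (hN.2 u v).trans (by lia))
end

section
/- For every constant β ≥ 1 there exist constants α and C such that the following holds: on the class of connected n-vertex graphs in which every vertex has degree at least α·(log n)² and the vertices carry distinct identifiers from {1, …, n^β}, the property AMOS admits a 2-local proof-labeling scheme of size at most C·log log n. -/
open SimpleGraph Filter

/-- If `d` is large compared with the number of colours, some colouring shows every colour
inside each member of a family of sets of size at least `d`. -/
theorem exists_coloring_surjOn {V κ ι : Type*} [Fintype V] [Fintype κ] [Fintype ι]
    (S : ι → Finset V) (d : ℕ) (hd : ∀ i, d ≤ (S i).card)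
    (h : (Fintype.card ι * Fintype.card κ : ℝ) * (1 - 1 / (Fintype.card κ : ℝ)) ^ d < 1)
    [Nonempty κ] :
    ∃ c : V → κ, ∀ i s, ∃ u ∈ S i, c u = s := by
  classical
  by_contra! hbad
  let B : ι × κ → Finset (V → κ) := fun p =>
    Fintype.piFinset fun u => if u ∈ S p.1 then Finset.univ.erase p.2 else Finset.univ
  set k : ℝ := (Fintype.card κ : ℝ) with hk
  have hk1 : 1 ≤ k := by
    rw [hk]; exact_mod_cast Fintype.card_pos
  have hk0 : 0 < k := by linarith
  have hq0 : 0 ≤ 1 - 1 / k := by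
    rw [sub_nonneg, div_le_one hk0]; exact hk1
  have hq1 : 1 - 1 / k ≤ 1 := by
    have : 0 ≤ 1 / k := by positivity
    linarith
  have hB : ∀ p, ((B p).card : ℝ) ≤ k ^ Fintype.card V * (1 - 1 / k) ^ d := by
    intro p
    have hcard : ((B p).card : ℝ) =
        ∏ u : V, (k * if u ∈ S p.1 then 1 - 1 / k else 1) := by
      rw [Fintype.card_piFinset]
      push_cast
      refine Finset.prod_congr rfl fun u _ => ?_
      split_ifs
      · rw [Finset.card_erase_of_mem (Finset.mem_univ _), Finset.card_univ,
          Nat.cast_sub Fintype.card_pos]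
        field_simp
        simp [hk]
      · simp [hk]
    rw [hcard, Finset.prod_mul_distrib, Finset.prod_const, Finset.card_univ]
    gcongr
    rw [Finset.prod_ite_mem, Finset.univ_inter, Finset.prod_const]
    exact pow_le_pow_of_le_one hq0 hq1 (hd p.1)
  have hcover : (Finset.univ : Finset (V → κ)) ⊆ Finset.univ.biUnion B := by
    intro c _
    obtain ⟨i, s, his⟩ := hbad c
    refine Finset.mem_biUnion.2 ⟨(i, s), Finset.mem_univ _, ?_⟩
    refine Fintype.mem_piFinset.2 fun u => ?_
    split_ifs with hu
    · exact Finset.mem_erase.2 ⟨his u hu, Finset.mem_univ _⟩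
    · exact Finset.mem_univ _
  have hle : k ^ Fintype.card V ≤
      (Fintype.card ι * k) * (k ^ Fintype.card V * (1 - 1 / k) ^ d) := by
    calc k ^ Fintype.card V = ((Finset.univ : Finset (V → κ)).card : ℝ) := by simp [hk]
      _ ≤ ((Finset.univ.biUnion B).card : ℝ) := by exact_mod_cast Finset.card_le_card hcover
      _ ≤ ∑ p, ((B p).card : ℝ) := by exact_mod_cast Finset.card_biUnion_le
      _ ≤ ∑ _p : ι × κ, k ^ Fintype.card V * (1 - 1 / k) ^ d :=
        Finset.sum_le_sum fun p _ => hB p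
      _ = _ := by simp [hk]
  have hpos : 0 < k ^ Fintype.card V := by positivity
  nlinarith

/-- The certificates visible in the closed neighbourhood of `w`. -/
def Network.nearbyCerts (N : Network) (P : Fin N.n → List Bool) (w : Fin N.n) :
    Set (List Bool) :=
  {l | ∃ u, (u = w ∨ N.G.Adj w u) ∧ P u = l}

/-- The codes of the positions of the binary digits `1` of `i`. -/
def bitCodes (i : ℕ) : Set (List Bool) :=
  {l | ∃ j, i.testBit j = true ∧ Nat.bits j = l}

theorem Nat.bits_injective : Function.Injective Nat.bits := by
  have : Function.LeftInverse
      (fun l : List Bool => l.foldr (fun b n => Nat.bit b n) 0) Nat.bits := by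
    intro n
    induction n using Nat.binaryRec' with
    | zero => simp
    | bit b n h ih => rw [Nat.bits_append_bit n b h]; simp [ih]
  exact this.injective

theorem bitCodes_injective : Function.Injective bitCodes := by
  intro a b h
  refine Nat.eq_of_testBit_eq fun j => ?_
  have key : ∀ i, Nat.bits j ∈ bitCodes i ↔ i.testBit j = true := fun i =>
    ⟨fun ⟨m, hm, hmj⟩ => Nat.bits_injective hmj ▸ hm, fun hj => ⟨j, hj, rfl⟩⟩
  rw [Bool.eq_iff_iff, ← key, ← key, h]

/-- The condition checked at `v`: all neighbours see the same certificates as `v`, and if `v` is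
selected then these certificates spell out its identifier. -/
def Network.Accepts (N : Network) (P : Fin N.n → List Bool) (v : Fin N.n) : Prop :=
  (∀ w, N.G.Adj v w → N.nearbyCerts P w = N.nearbyCerts P v) ∧
    (N.sel v = true → N.nearbyCerts P v = bitCodes (N.ids v))

theorem Network.mem_ball_two_of_near (N : Network) {v w u : Fin N.n}
    (hw : w = v ∨ N.G.Adj v w) (hu : u = w ∨ N.G.Adj w u) : u ∈ N.ball 2 v := by
  have h1 : N.G.dist v w ≤ 1 := by
    rcases hw with rfl | hw
    · simp
    · exact (SimpleGraph.dist_eq_one_iff_adj.2 hw).le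
  have h2 : N.G.dist w u ≤ 1 := by
    rcases hu with rfl | hu
    · simp
    · exact (SimpleGraph.dist_eq_one_iff_adj.2 hu).le
  have h3 := N.conn.dist_triangle (u := v) (v := w) (w := u)
  change N.G.dist v u ≤ 2
  omega

section Locality

variable {N N' : Network} {P : Fin N.n → List Bool} {P' : Fin N'.n → List Bool}
  {v : Fin N.n} {v' : Fin N'.n}
  (φ : (N.G.induce (N.ball 2 v)) ≃g (N'.G.induce (N'.ball 2 v')))

theorem near_map {x y : N.ball 2 v} (h : y.1 = x.1 ∨ N.G.Adj x.1 y.1) :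
    (φ y).1 = (φ x).1 ∨ N'.G.Adj (φ x).1 (φ y).1 := by
  rcases h with h | h
  · exact Or.inl (by rw [Subtype.ext h])
  · exact Or.inr (φ.map_adj_iff.2 h)

theorem nearbyCerts_subset_map (hP : ∀ x : N.ball 2 v, P x.1 = P' (φ x).1)
    (x : N.ball 2 v) (hx : x.1 = v ∨ N.G.Adj v x.1) :
    N.nearbyCerts P x.1 ⊆ N'.nearbyCerts P' (φ x).1 := by
  rintro l ⟨u, hu, rfl⟩
  let y : N.ball 2 v := ⟨u, N.mem_ball_two_of_near hx hu⟩
  exact ⟨(φ y).1, near_map φ (x := x) (y := y) hu, (hP y).symm⟩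

theorem nearbyCerts_map (hP : ∀ x : N.ball 2 v, P x.1 = P' (φ x).1)
    (hv : φ ⟨v, N.center_mem_ball 2 v⟩ = ⟨v', N'.center_mem_ball 2 v'⟩)
    (x : N.ball 2 v) (hx : x.1 = v ∨ N.G.Adj v x.1) :
    N.nearbyCerts P x.1 = N'.nearbyCerts P' (φ x).1 := by
  refine (nearbyCerts_subset_map φ hP x hx).antisymm ?_
  have hx' := near_map φ (x := ⟨v, N.center_mem_ball 2 v⟩) (y := x) hx
  rw [hv] at hx'
  have := nearbyCerts_subset_map (P := P') (P' := P) φ.symm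
    (fun y => by rw [hP, RelIso.apply_symm_apply]) (φ x) hx'
  rwa [RelIso.symm_apply_apply] at this

theorem Network.Accepts.map (hsel : ∀ x : N.ball 2 v, N.sel x.1 = N'.sel (φ x).1)
    (hids : ∀ x : N.ball 2 v, N.ids x.1 = N'.ids (φ x).1)
    (hP : ∀ x : N.ball 2 v, P x.1 = P' (φ x).1)
    (hv : φ ⟨v, N.center_mem_ball 2 v⟩ = ⟨v', N'.center_mem_ball 2 v'⟩)
    (h : N.Accepts P v) : N'.Accepts P' v' := by
  have hcenter : N.nearbyCerts P v = N'.nearbyCerts P' v' := by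
    have := nearbyCerts_map φ hP hv ⟨v, N.center_mem_ball 2 v⟩ (Or.inl rfl)
    rwa [hv] at this
  have hsel' := hsel ⟨v, N.center_mem_ball 2 v⟩
  have hids' := hids ⟨v, N.center_mem_ball 2 v⟩
  rw [hv] at hsel' hids'
  refine ⟨fun w' hw' => ?_, fun hs => ?_⟩
  · let y' : N'.ball 2 v' := ⟨w', N'.mem_ball_two_of_near (Or.inr hw') (Or.inl rfl)⟩
    have hadj : N.G.Adj v (φ.symm y').1 := by
      have : (N'.G.induce (N'.ball 2 v')).Adj (φ ⟨v, N.center_mem_ball 2 v⟩)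
          (φ (φ.symm y')) := by
        rw [hv, RelIso.apply_symm_apply]
        exact hw'
      exact φ.map_adj_iff.1 this
    have := nearbyCerts_map φ hP hv (φ.symm y') (Or.inr hadj)
    rw [RelIso.apply_symm_apply] at this
    rw [← hcenter, ← h.1 _ hadj, this]
  · rw [← hcenter, ← hids']
    exact h.2 (hsel'.trans hs)

end Locality

open Classical in
/-- The verifier accepting exactly when `Network.Accepts` holds. -/
noncomputable def amosVerifier : Verifier := fun N P v => decide (N.Accepts P v)

theorem amosVerifier_local : IsLocalVerifier 2 amosVerifier := by
  intro N N' P P' v v' φ hsel hids hP hv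
  have hv' : φ.symm ⟨v', N'.center_mem_ball 2 v'⟩ = ⟨v, N.center_mem_ball 2 v⟩ := by
    rw [← hv, RelIso.symm_apply_apply]
  simp only [amosVerifier, decide_eq_decide]
  exact ⟨.map φ hsel hids hP hv, .map φ.symm
    (fun x => by rw [hsel, RelIso.apply_symm_apply])
    (fun x => by rw [hids, RelIso.apply_symm_apply])
    (fun x => by rw [hP, RelIso.apply_symm_apply]) hv'⟩

theorem Network.amos_of_accepts (N : Network) (P : Fin N.n → List Bool)
    (h : ∀ v, N.Accepts P v) : N.AMOS := by
  have hwalk : ∀ u v, N.nearbyCerts P u = N.nearbyCerts P v := by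
    intro u v
    obtain ⟨p⟩ := N.conn.preconnected u v
    induction p with
    | nil => rfl
    | cons hadj _ ih => exact ((h _).1 _ hadj).symm.trans ih
  intro u v hu hv
  apply N.ids_inj
  apply bitCodes_injective
  rw [← (h u).2 hu, ← (h v).2 hv, hwalk u v]

/-- Certificates that every vertex accepts, from a colouring by the positions of the ones. -/
theorem Network.exists_accepted_certs (N : Network) (hN : N.AMOS) (L s : ℕ)
    (hL : ∀ v, N.ids v < 2 ^ L) (hpos : ∀ v, 1 ≤ N.ids v)
    (hs : ∀ j < L, j.size ≤ s)
    (hcol : ∀ κ : Finset ℕ, κ.Nonempty → κ.card ≤ L → ∃ c : Fin N.n → κ,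
      ∀ w j, ∃ u, (u = w ∨ N.G.Adj w u) ∧ c u = j) :
    ∃ P : Fin N.n → List Bool, (∀ v, (P v).length ≤ s) ∧ ∀ v, N.Accepts P v := by
  by_cases hsel : ∃ a, N.sel a = true
  · obtain ⟨a, ha⟩ := hsel
    let κ := (Finset.range L).filter fun j => (N.ids a).testBit j = true
    have hmem : ∀ j, j ∈ κ ↔ (N.ids a).testBit j = true := by
      intro j
      simp only [κ, Finset.mem_filter, Finset.mem_range, and_iff_right_iff_imp]
      intro hj
      by_contra! hle
      rw [Nat.testBit_lt_two_pow ((hL a).trans_le (Nat.pow_le_pow_right two_pos hle))] at hj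
      exact absurd hj (by decide)
    have hne : κ.Nonempty := by
      obtain ⟨j, hj⟩ := Nat.exists_testBit_of_ne_zero (Nat.one_le_iff_ne_zero.1 (hpos a))
      exact ⟨j, (hmem j).2 hj⟩
    obtain ⟨c, hc⟩ := hcol κ hne ((Finset.card_filter_le _ _).trans (Finset.card_range L).le)
    have hcerts : ∀ w, N.nearbyCerts (fun u => Nat.bits (c u).1) w = bitCodes (N.ids a) := by
      intro w
      ext l
      constructor
      · rintro ⟨u, -, rfl⟩
        exact ⟨_, (hmem _).1 (c u).2, rfl⟩
      · rintro ⟨j, hj, rfl⟩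
        obtain ⟨u, hu, huj⟩ := hc w ⟨j, (hmem j).2 hj⟩
        exact ⟨u, hu, congrArg (fun x => Nat.bits x.1) huj⟩
    refine ⟨fun u => Nat.bits (c u).1, fun v => ?_, fun v => ⟨fun w _ => ?_, fun hv => ?_⟩⟩
    · refine (Nat.size_eq_bits_len _).le.trans ?_
      exact hs _ (Finset.mem_range.1 (Finset.mem_filter.1 (c v).2).1)
    · rw [hcerts, hcerts]
    · rw [hcerts, hN v a hv ha]
  · refine ⟨fun _ => [], fun v => Nat.zero_le _, fun v => ⟨fun w _ => ?_, fun hv =>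
      (hsel ⟨v, hv⟩).elim⟩⟩
    have : ∀ w, N.nearbyCerts (fun _ => []) w = {[]} := by
      intro w
      ext l
      exact ⟨fun ⟨_, _, h⟩ => h.symm, fun h => ⟨w, Or.inl rfl, h.symm⟩⟩
    rw [this, this]

/-- The union bound for `n` vertices of degree `d` and `k` colours. -/
theorem union_bound_lt_one {β n k d L : ℕ} (hβ : 1 ≤ β) (hn : 2 ≤ n) (hk : 0 < k)
    (hkL : k ≤ L) (hL : L = β * (Nat.log 2 n + 1))
    (hd : 4 * β * (β + 1) * (Real.logb 2 n) ^ 2 ≤ (d : ℝ)) :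
    (n * k : ℝ) * (1 - 1 / (k : ℝ)) ^ d < 1 := by
  have hn0 : (0 : ℝ) < n := by positivity
  have hk0 : (0 : ℝ) < k := by exact_mod_cast hk
  have hk1 : (1 : ℝ) ≤ k := by exact_mod_cast hk
  have hβ1 : (1 : ℝ) ≤ β := by exact_mod_cast hβ
  set x := Real.logb 2 n with hx
  have hx1 : 1 ≤ x := by
    rw [hx, Real.le_logb_iff_rpow_le one_lt_two hn0, Real.rpow_one]
    exact_mod_cast hn
  have hkx : (k : ℝ) ≤ 2 * β * x := by
    have h1 : ((Nat.log 2 n : ℕ) : ℝ) ≤ x := Real.natLog_le_logb n 2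
    have h2 : (k : ℝ) ≤ β * (Nat.log 2 n + 1) := by exact_mod_cast hL ▸ hkL
    nlinarith
  have hkn : (k : ℝ) ≤ n ^ β := by
    have h1 : β ≤ 2 ^ (β - 1) := by
      have := Nat.lt_two_pow_self (n := β - 1)
      omega
    have h2 : Nat.log 2 n + 1 ≤ n := Nat.log_lt_self 2 (by omega)
    have h3 : k ≤ n ^ β := calc
      k ≤ β * (Nat.log 2 n + 1) := hL ▸ hkL
      _ ≤ n ^ (β - 1) * n := Nat.mul_le_mul (h1.trans (Nat.pow_le_pow_left hn _)) h2
      _ = n ^ β := by rw [← pow_succ, Nat.sub_add_cancel hβ]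
    exact_mod_cast h3
  have hlog : Real.log (n * k) < d / k := by
    have h1 : Real.log (n * k) ≤ (β + 1) * Real.log n := by
      calc Real.log (n * k) ≤ Real.log (n ^ (β + 1)) := by
            refine Real.log_le_log (by positivity) ?_
            rw [pow_succ]
            nlinarith
        _ = _ := by rw [Real.log_pow]; push_cast; ring
    have h2 : Real.log n ≤ x := by
      rw [hx, ← Real.log_div_log, le_div_iff₀ (Real.log_pos one_lt_two)]
      have := Real.log_two_lt_d9
      have : 0 ≤ Real.log n := Real.log_natCast_nonneg n
      nlinarith
    rw [lt_div_iff₀ hk0]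
    have h3 : Real.log (n * k) ≤ (β + 1) * x := h1.trans (by gcongr)
    calc Real.log (n * k) * k ≤ ((β + 1) * x) * (2 * β * x) := by gcongr
      _ < 4 * β * (β + 1) * x ^ 2 := by
        have : 0 < β * (β + 1) * x ^ 2 := by positivity
        nlinarith
      _ ≤ d := hd
  have hq0 : 0 ≤ 1 - 1 / (k : ℝ) := by
    rw [sub_nonneg, div_le_one hk0]; exact hk1
  have hpow : (1 - 1 / (k : ℝ)) ^ d ≤ Real.exp (-(d / k)) := by
    calc (1 - 1 / (k : ℝ)) ^ d ≤ Real.exp (-(1 / k)) ^ d := by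
          gcongr
          exact Real.one_sub_le_exp_neg _
      _ = _ := by rw [← Real.exp_nat_mul]; congr 1; ring
  calc (n * k : ℝ) * (1 - 1 / (k : ℝ)) ^ d ≤ (n * k) * Real.exp (-(d / k)) := by gcongr
    _ < Real.exp (d / k) * Real.exp (-(d / k)) := by
      gcongr
      exact (Real.log_lt_iff_lt_exp (by positivity)).1 hlog
    _ = 1 := by rw [← Real.exp_add]; simp

theorem Nat.size_le_mul_log_log {β n j : ℕ} (hn : 4 ≤ n) (hj : j < β * (Nat.log 2 n + 1)) :
    j.size ≤ (β + 2) * Nat.log 2 (Nat.log 2 n) := by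
  set l := Nat.log 2 n with hl
  have hl2 : 2 ≤ l := (Nat.le_log_iff_pow_le one_lt_two (by omega)).2 (by omega)
  set m := Nat.log 2 l with hm
  have hm1 : 1 ≤ m := (Nat.le_log_iff_pow_le one_lt_two (by omega)).2 (by omega)
  have hlm : l + 1 ≤ 2 ^ (m + 1) := Nat.lt_pow_succ_log_self one_lt_two l
  have h1 : j.size ≤ β + (m + 1) := by
    rw [Nat.size_le, pow_add]
    exact hj.trans_le (Nat.mul_le_mul Nat.lt_two_pow_self.le hlm)
  nlinarith

theorem Network.exists_short_accepted_certs {β : ℕ} (hβ : 1 ≤ β) (N : Network)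
    (hdeg : ∀ v, (4 * β * (β + 1) : ℝ) * (Real.logb 2 N.n) ^ 2 ≤
      ((N.G.neighborSet v).ncard : ℝ))
    (hids : ∀ v, 1 ≤ N.ids v ∧ N.ids v ≤ N.n ^ β) (hN : N.AMOS) :
    ∃ P : Fin N.n → List Bool,
      (∀ v, (P v).length ≤ (β + 2) * Nat.log 2 (Nat.log 2 N.n)) ∧ ∀ v, N.Accepts P v := by
  classical
  have := N.conn.nonempty
  obtain ⟨v₀⟩ := N.conn.nonempty
  obtain hn1 | hn2 : N.n = 1 ∨ 2 ≤ N.n := by have := v₀.2; omega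
  · refine N.exists_accepted_certs hN 1 _ (fun v => ?_) (fun v => (hids v).1) ?_ ?_
    · have := (hids v).2
      rw [hn1, one_pow] at this
      omega
    · intro j hj
      obtain rfl : j = 0 := by omega
      simp
    · rintro κ ⟨a, ha⟩ hκ
      refine ⟨fun _ => ⟨a, ha⟩, fun w j => ⟨w, Or.inl rfl, ?_⟩⟩
      exact Subtype.ext (Finset.card_le_one.1 hκ _ ha _ j.2)
  have hncard : ∀ v, (N.G.neighborSet v).ncard = N.G.degree v := fun v => by
    rw [Set.ncard_eq_toFinset_card', ← SimpleGraph.card_neighborFinset_eq_degree,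
      SimpleGraph.neighborFinset]
  have hlog1 : 1 ≤ Real.logb 2 N.n := by
    rw [Real.le_logb_iff_rpow_le one_lt_two (by positivity), Real.rpow_one]
    exact_mod_cast hn2
  have hn4 : 4 ≤ N.n := by
    have h1 := hdeg v₀
    have h2 : N.G.degree v₀ < N.n := by
      simpa using N.G.degree_lt_card_verts v₀
    have h3 : (1 : ℝ) ≤ β := by exact_mod_cast hβ
    have h4 : (8 : ℝ) ≤ 4 * β * (β + 1) := by nlinarith
    have h5 : (1 : ℝ) ≤ Real.logb 2 N.n ^ 2 := one_le_pow₀ hlog1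
    rw [hncard] at h1
    have h6 : (8 : ℝ) ≤ (N.G.degree v₀ : ℝ) := by nlinarith
    have : 8 ≤ N.G.degree v₀ := by exact_mod_cast h6
    omega
  refine N.exists_accepted_certs hN (β * (Nat.log 2 N.n + 1)) _ (fun v => ?_)
    (fun v => (hids v).1) (fun j hj => Nat.size_le_mul_log_log hn4 hj) ?_
  · refine (hids v).2.trans_lt ?_
    rw [mul_comm, pow_mul]
    exact Nat.pow_lt_pow_left (Nat.lt_pow_succ_log_self one_lt_two _) (by omega)
  · intro κ hκ hκL
    have : Nonempty κ := hκ.to_subtype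
    obtain ⟨c, hc⟩ := exists_coloring_surjOn (κ := κ)
      (fun w => N.G.neighborFinset w) N.G.minDegree
      (fun w => by simpa using N.G.minDegree_le_degree w) (by
        obtain ⟨v, hv⟩ := N.G.exists_minimal_degree_vertex
        have := hdeg v
        rw [hncard, ← hv] at this
        simpa using union_bound_lt_one hβ hn2 hκ.card_pos hκL rfl this)
    refine ⟨c, fun w j => ?_⟩
    obtain ⟨u, hu, huj⟩ := hc w j
    exact ⟨u, Or.inr (by simpa using hu), huj⟩

/-- In everywhere-dense graphs (minimum degree at least `α (log₂ n)²`), AMOS can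
be certified with `O(log log n)` bits: for every `β ≥ 1` there are constants
`α` and `C` such that AMOS admits a 2-local proof-labeling scheme of size
`C · log log n` on connected `n`-vertex graphs of minimum degree at least
`α (log₂ n)²` whose vertices carry distinct identifiers from `{1, …, n^β}`. -/
theorem amos_dense_loglog (β : ℕ) (hβ : 1 ≤ β) :
    ∃ (α : ℝ) (C : ℕ), 0 < α ∧
      Nonempty (PLS 2 (fun n => C * Nat.log 2 (Nat.log 2 n))
        (fun N => (∀ v : Fin N.n, α * (Real.logb 2 N.n) ^ 2 ≤ ((N.G.neighborSet v).ncard : ℝ)) ∧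
          (∀ v : Fin N.n, 1 ≤ N.ids v ∧ N.ids v ≤ N.n ^ β))
        Network.AMOS) := by
  classical
  have hcerts := fun (N : Network) hdeg hids hN =>
    N.exists_short_accepted_certs hβ hdeg hids hN
  refine ⟨4 * β * (β + 1), β + 2, by positivity, ⟨{
    prover := fun N => if h : _ ∧ _ ∧ _ then
      (hcerts N h.1 h.2.1 h.2.2).choose else fun _ => []
    verifier := amosVerifier
    verifier_local := amosVerifier_local
    prover_size := fun N hNet hN v => ?_
    completeness := fun N hNet hN v => ?_
    soundness := fun N _ hN P => ?_ }⟩⟩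
  · rw [dif_pos ⟨hNet.1, hNet.2, hN⟩]
    exact (hcerts N hNet.1 hNet.2 hN).choose_spec.1 v
  · rw [dif_pos ⟨hNet.1, hNet.2, hN⟩]
    exact decide_eq_true ((hcerts N hNet.1 hNet.2 hN).choose_spec.2 v)
  · by_contra! h
    exact hN (N.amos_of_accepts P fun v => of_decide_eq_true (by simpa [amosVerifier] using h v))
end

section
/- There exists N such that for every n ≥ N the following holds: for every finite set of colors C with |C| < n^(1/3) and every coloring c : {1,…,n} × {1,…,n} → C of the edges of the complete bipartite graph K_{n,n}, there exist indices i ≠ j in the first part and k ≠ l in the second part such that c(i,k) = c(i,l) = c(j,k) = c(j,l); that is, the coloring contains a monochromatic 4-cycle. -/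
open Finset in
/-- The number of ordered pairs of distinct elements that a map to `C` identifies is at least
`|α|² / |C| - |α|`. -/
theorem sq_card_le_card_mul_card_offDiag_filter_add {α C : Type*} [Fintype α] [Fintype C]
    [DecidableEq α] [DecidableEq C] (f : α → C) :
    Fintype.card α ^ 2 ≤
      Fintype.card C * (#{p ∈ (univ : Finset α).offDiag | f p.1 = f p.2} + Fintype.card α) := by
  have fiber_sum : Fintype.card α = ∑ c, #{a | f a = c} :=
    card_eq_sum_card_fiberwise (s := univ) (t := univ) (fun _ _ => by simp)
  have pair_sum : #{p : α × α | f p.1 = f p.2} = ∑ c, #{a | f a = c} ^ 2 := by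
    rw [card_eq_sum_card_fiberwise (f := fun p : α × α => f p.1) (t := univ)
      (fun _ _ => by simp)]
    refine sum_congr rfl fun c _ => ?_
    rw [sq, ← card_product]
    congr 1
    ext p
    simp only [mem_filter, mem_univ, true_and, mem_product]
    grind
  have pair_split : #{p : α × α | f p.1 = f p.2} ≤
      #{p ∈ (univ : Finset α).offDiag | f p.1 = f p.2} + Fintype.card α := by
    rw [← card_univ, ← diag_card (univ : Finset α)]
    refine (card_le_card fun p hp => ?_).trans (card_union_le _ _)
    simp only [mem_filter, mem_univ, true_and, mem_union, mem_offDiag, mem_diag] at hp ⊢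
    tauto
  calc Fintype.card α ^ 2 = (∑ c, #{a | f a = c}) ^ 2 := by rw [← fiber_sum]
    _ ≤ Fintype.card C * ∑ c, #{a | f a = c} ^ 2 := sq_sum_le_card_mul_sum_sq
    _ ≤ _ := Nat.mul_le_mul_left _ (pair_sum ▸ pair_split)

open Finset in
/-- A coloring of `α × β` without monochromatic 4-cycles has at most one row for each color and
each ordered pair of columns in which both entries get that color. -/
theorem sum_card_offDiag_filter_le_of_no_monochromatic_four_cycle {α β C : Type*} [Fintype α]
    [Fintype β] [Fintype C] [DecidableEq β] [DecidableEq C] (c : α × β → C)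
    (hc : ∀ i j k l, i ≠ j → k ≠ l → c (i, k) = c (i, l) → c (i, k) = c (j, k) →
      c (i, k) ≠ c (j, l)) :
    ∑ i, #{p ∈ (univ : Finset β).offDiag | c (i, p.1) = c (i, p.2)} ≤
      Fintype.card C * Fintype.card β ^ 2 := by
  rw [← card_sigma, sq, ← Fintype.card_prod, ← Fintype.card_prod, ← card_univ]
  refine card_le_card_of_injOn (fun x => (c (x.1, x.2.1), x.2)) (fun _ _ => by simp) ?_
  rintro ⟨i, p⟩ hi ⟨j, q⟩ hj h
  simp only [coe_sigma, Set.mem_sigma_iff, mem_coe, mem_univ, true_and, mem_filter,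
    mem_offDiag] at hi hj
  obtain ⟨hcol, rfl⟩ := Prod.mk.inj h
  by_cases hij : i = j
  · rw [hij]
  · exact absurd (hcol.trans hj.2) (hc i j p.1 p.2 hij hi.1 hi.2 hcol)

/-- For all sufficiently large `n`, every edge coloring of the complete
bipartite graph `K_{n,n}` with fewer than `n^(1/3)` colors contains a
monochromatic 4-cycle: there are `i ≠ j` on one side and `k ≠ l` on the other
side such that the four edges `(i,k), (i,l), (j,k), (j,l)` all receive the same
color. -/
theorem monochromatic_four_cycle_in_Knn :
    ∃ N : ℕ, ∀ n : ℕ, N ≤ n →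
      ∀ (C : Type) [Fintype C],
        (Fintype.card C : ℝ) < (n : ℝ) ^ ((1 : ℝ) / 3) →
        ∀ c : Fin n × Fin n → C,
          ∃ i j k l : Fin n, i ≠ j ∧ k ≠ l ∧
            c (i, k) = c (i, l) ∧ c (i, k) = c (j, k) ∧ c (i, k) = c (j, l) := by
  classical
  refine ⟨3, fun n hn C _ hC c => ?_⟩
  by_contra! hc
  have rows := Finset.sum_le_sum fun i (_ : i ∈ (Finset.univ : Finset (Fin n))) =>
    sq_card_le_card_mul_card_offDiag_filter_add fun k => c (i, k)
  have total := sum_card_offDiag_filter_le_of_no_monochromatic_four_cycle c hc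
  rw [← Finset.mul_sum, Finset.sum_add_distrib] at rows
  simp only [Finset.sum_const, Finset.card_univ, Fintype.card_fin, smul_eq_mul] at rows total
  have cube_lt : Fintype.card C ^ 3 < n := by
    have h := pow_lt_pow_left₀ hC (Nat.cast_nonneg _) (n := 3) (by norm_num)
    rw [← Real.rpow_natCast ((n : ℝ) ^ ((1 : ℝ) / 3)), ← Real.rpow_mul (Nat.cast_nonneg n)] at h
    norm_num at h
    exact_mod_cast h
  generalize Fintype.card C = m at *
  have le_sq_add : n ≤ m ^ 2 + m := by
    refine Nat.le_of_mul_le_mul_right (c := n ^ 2) ?_ (by positivity)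
    calc n * n ^ 2 ≤ m * (m * n ^ 2 + n * n) := rows.trans (by gcongr)
      _ = (m ^ 2 + m) * n ^ 2 := by ring
  rcases Nat.lt_or_ge m 2 with hm | hm
  · interval_cases m <;> omega
  · nlinarith [Nat.mul_le_mul_right (m ^ 2) hm, Nat.mul_le_mul_right m hm]
end

section
/- For every real β > 0 there exists a real α > 0 such that for every integer n ≥ 2 the following holds: for every simple graph G on n vertices in which every vertex has degree at least α·(log n)², setting m = ⌈β·log n⌉, there exists a function f : V(G) → {1, …, m} such that for every vertex v and every b ∈ {1, …, m} some neighbor u of v satisfies f(u) = b (i.e., every vertex sees all m values in its open neighborhood). -/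
/-- Functions avoiding the value `b` on `S` make up at most an `exp (-|S| / m)` fraction of all
functions into `Fin m`. -/
theorem card_forall_mem_ne_le {V : Type*} [Fintype V] [DecidableEq V] {m : ℕ} (S : Finset V)
    (b : Fin m) :
    ((Finset.univ.filter fun f : V → Fin m => ∀ u ∈ S, f u ≠ b).card : ℝ) ≤
      (m : ℝ) ^ Fintype.card V * Real.exp (-(S.card / m)) := by
  have hm : 0 < m := b.pos
  have hm' : (0 : ℝ) < m := by exact_mod_cast hm
  have hpi : (Finset.univ.filter fun f : V → Fin m => ∀ u ∈ S, f u ≠ b) =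
      Fintype.piFinset fun u => if u ∈ S then {b}ᶜ else Finset.univ := by
    ext f
    simp only [Finset.mem_filter, Finset.mem_univ, true_and, Fintype.mem_piFinset]
    refine forall_congr' fun u => ?_
    split_ifs with h <;> simp [h]
  have hcard (u : V) : (((if u ∈ S then {b}ᶜ else Finset.univ : Finset (Fin m)).card : ℕ) : ℝ) ≤
      m * if u ∈ S then Real.exp (-(1 / m)) else 1 := by
    split_ifs with h
    · have hexp := Real.add_one_le_exp (-(1 / m : ℝ))
      calc ((({b}ᶜ : Finset (Fin m)).card : ℕ) : ℝ) = m * (-(1 / m) + 1) := by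
            rw [Finset.card_compl, Fintype.card_fin, Finset.card_singleton, Nat.cast_sub hm]
            push_cast
            field_simp
            ring
        _ ≤ _ := by gcongr
    · simp
  rw [hpi, Fintype.card_piFinset, Nat.cast_prod]
  refine (Finset.prod_le_prod (fun _ _ => Nat.cast_nonneg _) fun u _ => hcard u).trans ?_
  rw [Finset.prod_mul_distrib, Finset.prod_const, Finset.prod_ite_mem, Finset.univ_inter,
    Finset.prod_const, ← Real.exp_nat_mul, Finset.card_univ]
  refine le_of_eq ?_
  congr 2
  ring

/-- Union bound: if every set of a family has at least `d` elements and the family has fewer than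
`exp (d / m) / m` members, some function to `Fin m` takes all values on each of the sets. -/
theorem exists_forall_exists_mem_eq {ι V : Type*} [Fintype ι] [Fintype V] {m : ℕ} (hm : 0 < m)
    (S : ι → Finset V) (d : ℝ) (hS : ∀ i, d ≤ (S i).card)
    (hd : (Fintype.card ι : ℝ) * m < Real.exp (d / m)) :
    ∃ f : V → Fin m, ∀ i b, ∃ u ∈ S i, f u = b := by
  classical
  by_contra! hbad
  have hm' : (0 : ℝ) < m := by exact_mod_cast hm
  have hcover : (Finset.univ : Finset (V → Fin m)) ⊆
      (Finset.univ : Finset (ι × Fin m)).biUnion fun p =>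
        Finset.univ.filter fun f : V → Fin m => ∀ u ∈ S p.1, f u ≠ p.2 := by
    intro f _
    obtain ⟨i, b, h⟩ := hbad f
    simp only [Finset.mem_biUnion, Finset.mem_filter, Finset.mem_univ, true_and]
    exact ⟨(i, b), h⟩
  have hle : (m : ℝ) ^ Fintype.card V ≤
      Fintype.card ι * m * ((m : ℝ) ^ Fintype.card V * Real.exp (-(d / m))) := by
    calc (m : ℝ) ^ Fintype.card V = ((Finset.univ : Finset (V → Fin m)).card : ℝ) := by
          simp
      _ ≤ ∑ p : ι × Fin m,
          ((Finset.univ.filter fun f : V → Fin m => ∀ u ∈ S p.1, f u ≠ p.2).card : ℝ) := by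
          exact_mod_cast (Finset.card_le_card hcover).trans Finset.card_biUnion_le
      _ ≤ ∑ _p : ι × Fin m, (m : ℝ) ^ Fintype.card V * Real.exp (-(d / m)) := by
          refine Finset.sum_le_sum fun p _ => (card_forall_mem_ne_le (S p.1) p.2).trans ?_
          gcongr
          exact hS p.1
      _ = _ := by simp
  have hpow : (0 : ℝ) < (m : ℝ) ^ Fintype.card V := by positivity
  have hlt : (Fintype.card ι : ℝ) * m * Real.exp (-(d / m)) < 1 := by
    rwa [Real.exp_neg, ← div_eq_mul_inv, div_lt_one (Real.exp_pos _)]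
  nlinarith [mul_lt_mul_of_pos_left hlt hpow]

/-- For every `β > 0` there is an `α > 0` such that in every `n`-vertex graph
(`n ≥ 2`) of minimum degree at least `α (log₂ n)²`, setting `m = ⌈β log₂ n⌉`,
one can assign to every vertex a value in `{1, …, m}` so that every vertex sees
all `m` values in its open neighborhood. -/
theorem exists_assignment_all_values_in_neighborhood :
    ∀ β : ℝ, 0 < β → ∃ α : ℝ, 0 < α ∧
      ∀ (n : ℕ), 2 ≤ n →
        ∀ (V : Type) [Fintype V] (G : SimpleGraph V),
          Fintype.card V = n →
          (∀ v : V, α * (Real.logb 2 n) ^ 2 ≤ ((G.neighborSet v).ncard : ℝ)) →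
          ∃ f : V → Fin ⌈β * Real.logb 2 n⌉₊,
            ∀ (v : V) (b : Fin ⌈β * Real.logb 2 n⌉₊),
              ∃ u : V, G.Adj v u ∧ f u = b := by
  classical
  intro β hβ
  refine ⟨(β + 1) * (β + 2), by positivity, fun n hn V _ G hV hdeg => ?_⟩
  have hn' : (2 : ℝ) ≤ n := by exact_mod_cast hn
  have hn0 : (0 : ℝ) < n := by linarith
  set L := Real.logb 2 n with hL
  have hL1 : 1 ≤ L := by
    rw [hL, Real.le_logb_iff_rpow_le one_lt_two hn0]
    simpa using hn'
  have hnL : (n : ℝ) ≤ Real.exp L := by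
    rw [← Real.log_le_iff_le_exp hn0, hL, Real.logb,
      le_div_iff₀ (Real.log_pos one_lt_two)]
    exact mul_le_of_le_one_right (Real.log_nonneg (by linarith)) (by linarith [Real.log_two_lt_d9])
  have hm : 0 < ⌈β * L⌉₊ := Nat.ceil_pos.2 (by positivity)
  have hm' : (0 : ℝ) < ⌈β * L⌉₊ := by exact_mod_cast hm
  have hmL : (⌈β * L⌉₊ : ℝ) ≤ (β + 1) * L := by
    linarith [Nat.ceil_lt_add_one (show 0 ≤ β * L by positivity)]
  have hcard (v : V) : (β + 1) * (β + 2) * L ^ 2 ≤ (G.neighborFinset v).card := by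
    rw [← Set.ncard_coe_finset, G.coe_neighborFinset]
    exact hdeg v
  have hexp : (Fintype.card V : ℝ) * ⌈β * L⌉₊ <
      Real.exp ((β + 1) * (β + 2) * L ^ 2 / ⌈β * L⌉₊) := by
    calc (Fintype.card V : ℝ) * ⌈β * L⌉₊ ≤ Real.exp L * ((β + 1) * L) := by
          rw [hV]
          gcongr
      _ < Real.exp L * Real.exp ((β + 1) * L) := by
          gcongr
          linarith [Real.add_one_le_exp ((β + 1) * L)]
      _ = Real.exp ((β + 2) * L) := by
          rw [← Real.exp_add]
          ring_nf
      _ ≤ _ := by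
          rw [Real.exp_le_exp, le_div_iff₀ hm']
          calc (β + 2) * L * ⌈β * L⌉₊ ≤ (β + 2) * L * ((β + 1) * L) := by gcongr
            _ = _ := by ring
  obtain ⟨f, hf⟩ := exists_forall_exists_mem_eq hm (fun v => G.neighborFinset v) _ hcard hexp
  exact ⟨f, fun v b => by simpa using hf v b⟩
end
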